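/- arXiv:2603.09299 — 5 statements merged into one kernel-verified Lean document; each statement's English description precedes it below -/
import Mathlib

section
/- Suppose CG < Cp and μ1 ≥ μ2. Then for every triple (j,k,l) of natural numbers with j ≥ 1, j+k+l = Cp and l ≥ CG, there exists a natural number N such that for all natural numbers i ≥ N one has D(i,j,k,l) = v(i,j-1,k+1,l) − v(i,j-1,k,l+1) ≤ 0. -/
/-- Total service rate `d(j,k,l) = j·μ0 + k·μ1 + min(l,CG)·μ2`. -/
noncomputable def dRate (μ0 μ1 μ2 : ℝ) (CG j k l : ℕ) : ℝ :=
  (j : ℝ) * μ0 + (k : ℝ) * μ1 + ((min l CG : ℕ) : ℝ) * μ2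

/-- The value function `v`, defined by well-founded recursion on `2(i+j)+k+l`.
For nonzero states of the state space it satisfies
`d(j,k,l) · v i j k l = holding costs + transition terms`
(terms with zero coefficient are guarded by `if` and contribute `0`). -/
noncomputable def v (μ0 μ1 μ2 h0 h1 h2 : ℝ) (CG : ℕ) : ℕ → ℕ → ℕ → ℕ → ℝ
  | 0, 0, 0, 0 => 0
  | 0, j, k, l =>
    ((j : ℝ) * h0 + (k : ℝ) * h1 + (l : ℝ) * h2
      + (if _ : 1 ≤ j then
          (j : ℝ) * μ0 *
            min (v μ0 μ1 μ2 h0 h1 h2 CG 0 (j - 1) (k + 1) l)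
                (v μ0 μ1 μ2 h0 h1 h2 CG 0 (j - 1) k (l + 1))
        else 0)
      + (if _ : 1 ≤ k then (k : ℝ) * μ1 * v μ0 μ1 μ2 h0 h1 h2 CG 0 j (k - 1) l else 0)
      + (if _ : 1 ≤ l then
          ((min l CG : ℕ) : ℝ) * μ2 * v μ0 μ1 μ2 h0 h1 h2 CG 0 j k (l - 1)
        else 0))
    / dRate μ0 μ1 μ2 CG j k l
  | i + 1, j, k, l =>
    (((i : ℝ) + 1 + (j : ℝ)) * h0 + (k : ℝ) * h1 + (l : ℝ) * h2
      + (if _ : 1 ≤ j then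
          (j : ℝ) * μ0 *
            min (v μ0 μ1 μ2 h0 h1 h2 CG (i + 1) (j - 1) (k + 1) l)
                (v μ0 μ1 μ2 h0 h1 h2 CG (i + 1) (j - 1) k (l + 1))
        else 0)
      + (if _ : 1 ≤ k then (k : ℝ) * μ1 * v μ0 μ1 μ2 h0 h1 h2 CG i (j + 1) (k - 1) l else 0)
      + (if _ : 1 ≤ l then
          ((min l CG : ℕ) : ℝ) * μ2 * v μ0 μ1 μ2 h0 h1 h2 CG i (j + 1) k (l - 1)
        else 0))
    / dRate μ0 μ1 μ2 CG j k l
termination_by i j k l => 2 * (i + j) + k + l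
decreasing_by all_goals omega

/-- Membership in the state space `X`. -/
def memX (Cp : ℕ) (i j k l : ℕ) : Prop :=
  (i = 0 ∧ j + k + l < Cp) ∨ j + k + l = Cp

/-- Abstract system: positivity of the parameters together with the Bellman equation. -/
structure Sys (μ0 μ1 μ2 h0 h1 h2 : ℝ) (CG : ℕ) (w : ℕ → ℕ → ℕ → ℕ → ℝ) : Prop where
  m0 : 0 < μ0
  m1 : 0 < μ1
  m2 : 0 < μ2
  p0 : 0 < h0
  p1 : 0 < h1
  p2 : 0 < h2
  cg : 0 < CG
  m21 : μ2 ≤ μ1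
  zero : ∀ i, w i 0 0 0 = 0 ∨ 0 < i
  zero' : ∀ i, 0 ≤ w i 0 0 0
  eq : ∀ i j k l : ℕ, (i = 0 ∨ 0 < j + k + l) →
    ((j : ℝ) * μ0 + (k : ℝ) * μ1 + ((min l CG : ℕ) : ℝ) * μ2) * w i j k l =
      ((i : ℝ) + j) * h0 + (k : ℝ) * h1 + (l : ℝ) * h2
      + (j : ℝ) * μ0 * min (w i (j - 1) (k + 1) l) (w i (j - 1) k (l + 1))
      + (k : ℝ) * μ1 * w (i - 1) (j + min i 1) (k - 1) l
      + ((min l CG : ℕ) : ℝ) * μ2 * w (i - 1) (j + min i 1) k (l - 1)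

theorem d_pos {μ0 μ1 μ2 : ℝ} {CG : ℕ} (m0 : 0 < μ0) (m1 : 0 < μ1) (m2 : 0 < μ2) (cg : 0 < CG)
    (j k l : ℕ) (h : 0 < j + k + l) :
    0 < (j : ℝ) * μ0 + (k : ℝ) * μ1 + ((min l CG : ℕ) : ℝ) * μ2 := by
  have a : 0 ≤ (j : ℝ) * μ0 := by positivity
  have b : 0 ≤ (k : ℝ) * μ1 := by positivity
  have c : 0 ≤ ((min l CG : ℕ) : ℝ) * μ2 := by positivity
  rcases Nat.eq_zero_or_pos j with hj | hj
  · rcases Nat.eq_zero_or_pos k with hk | hk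
    · have : 0 < min l CG := by omega
      have : 0 < ((min l CG : ℕ) : ℝ) * μ2 := by
        have : (0 : ℝ) < ((min l CG : ℕ) : ℝ) := by exact_mod_cast this
        positivity
      linarith
    · have : 0 < (k : ℝ) * μ1 := by positivity
      linarith
  · have : 0 < (j : ℝ) * μ0 := by positivity
    linarith

theorem sys_v {μ0 μ1 μ2 h0 h1 h2 : ℝ} {CG : ℕ}
    (hCG : 0 < CG)
    (hμ0 : 0 < μ0) (hμ1 : 0 < μ1) (hμ2 : 0 < μ2)
    (hh0 : 0 < h0) (hh1 : 0 < h1) (hh2 : 0 < h2)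
    (hμ : μ2 ≤ μ1) : Sys μ0 μ1 μ2 h0 h1 h2 CG (v μ0 μ1 μ2 h0 h1 h2 CG) := by
  refine ⟨hμ0, hμ1, hμ2, hh0, hh1, hh2, hCG, hμ, ?_, ?_, ?_⟩
  · intro i
    rcases i with _ | i
    · left; rw [v]
    · right; omega
  · intro i
    rcases i with _ | i
    · rw [v]
    · rw [v]; simp [dRate]
  · intro i j k l h
    by_cases hz : j + k + l = 0
    · have hi : i = 0 := by omega
      obtain ⟨rfl, rfl, rfl⟩ : j = 0 ∧ k = 0 ∧ l = 0 := by omega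
      subst hi
      simp
    · have hd := d_pos hμ0 hμ1 hμ2 hCG j k l (by omega)
      have hj0 : ¬ (1 ≤ j) → (j : ℝ) = 0 := by
        intro h; have : j = 0 := by omega
        simp [this]
      have hk0 : ¬ (1 ≤ k) → (k : ℝ) = 0 := by
        intro h; have : k = 0 := by omega
        simp [this]
      have hl0 : ¬ (1 ≤ l) → ((min l CG : ℕ) : ℝ) = 0 := by
        intro h; have : l = 0 := by omega
        simp [this]
      rcases i with _ | i
      · rw [v]
        · rw [dRate, mul_div_cancel₀ _ hd.ne']
          simp only [Nat.zero_sub, Nat.zero_min, Nat.add_zero, Nat.cast_zero, zero_add]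
          congr 1
          · congr 1
            · congr 1
              split_ifs with hc
              · rfl
              · rw [hj0 hc]; ring
            · split_ifs with hc
              · rfl
              · rw [hk0 hc]; ring
          · split_ifs with hc
            · rfl
            · rw [hl0 hc]; ring
        · intro a b c; omega
      · rw [v]
        rw [dRate, mul_div_cancel₀ _ hd.ne']
        have e : min (i + 1) 1 = 1 := by omega
        simp only [e, Nat.add_sub_cancel, Nat.cast_add, Nat.cast_one]
        congr 1
        · congr 1
          · congr 1
            split_ifs with hc
            · rfl
            · rw [hj0 hc]; ring
          · split_ifs with hc
            · rfl
            · rw [hk0 hc]; ring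
        · split_ifs with hc
          · rfl
          · rw [hl0 hc]; ring

theorem coef_le (n : ℕ) {μ x y : ℝ} (hμ : 0 ≤ μ) (h : 1 ≤ n → x ≤ y) :
    (n : ℝ) * μ * x ≤ (n : ℝ) * μ * y := by
  rcases Nat.eq_zero_or_pos n with hn | hn
  · simp [hn]
  · exact mul_le_mul_of_nonneg_left (h hn) (by positivity)

theorem coef_mono (a b : ℕ) {μ x y z : ℝ} (hab : a ≤ b) (hμ : 0 ≤ μ) (h : 1 ≤ a → x ≤ y)
    (h' : a < b → z ≤ y) :
    (a : ℝ) * μ * x + ((b : ℝ) * μ - (a : ℝ) * μ) * z ≤ (b : ℝ) * μ * y := by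
  obtain ⟨c, rfl⟩ := Nat.exists_eq_add_of_le hab
  have h1 := coef_le a hμ h
  have h2 : (c : ℝ) * μ * z ≤ (c : ℝ) * μ * y := coef_le c hμ (fun hc => h' (by omega))
  push_cast
  linarith

section
variable {μ0 μ1 μ2 h0 h1 h2 : ℝ} {CG : ℕ} {w : ℕ → ℕ → ℕ → ℕ → ℝ}

/-- With an empty waiting room, the value is monotone under adding jobs. -/
theorem mono0 (S : Sys μ0 μ1 μ2 h0 h1 h2 CG w) : ∀ n i' j' k' l' j k l : ℕ,
    2 * (i' + j') + k' + l' ≤ n → j ≤ j' → k ≤ k' → l ≤ l' → w 0 j k l ≤ w i' j' k' l' := by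
  intro n
  induction n with
  | zero =>
    intro i' j' k' l' j k l hn hj hk hl
    obtain ⟨rfl, rfl, rfl, rfl⟩ : i' = 0 ∧ j' = 0 ∧ k' = 0 ∧ l' = 0 := by omega
    obtain ⟨rfl, rfl, rfl⟩ : j = 0 ∧ k = 0 ∧ l = 0 := by omega
    exact le_rfl
  | succ n ih =>
    intro i' j' k' l' j k l hn hj hk hl
    by_cases hz : j' + k' + l' = 0
    · obtain ⟨rfl, rfl, rfl⟩ : j' = 0 ∧ k' = 0 ∧ l' = 0 := by omega
      obtain ⟨rfl, rfl, rfl⟩ : j = 0 ∧ k = 0 ∧ l = 0 := by omega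
      have := S.zero 0
      have h2 := S.zero' i'
      have : w 0 0 0 0 = 0 := by simpa using this
      linarith
    · have hd := d_pos S.m0 S.m1 S.m2 S.cg j' k' l' (by omega)
      have eA := S.eq 0 j k l (Or.inl rfl)
      have eB := S.eq i' j' k' l' (Or.inr (by omega))
      simp only [Nat.zero_sub, Nat.zero_min, Nat.add_zero, Nat.cast_zero, zero_add] at eA
      have t1 := coef_mono j j' (x := min (w 0 (j - 1) (k + 1) l) (w 0 (j - 1) k (l + 1)))
        (y := min (w i' (j' - 1) (k' + 1) l') (w i' (j' - 1) k' (l' + 1))) (z := w 0 j k l)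
        hj S.m0.le
        (fun h => min_le_min
          (ih _ _ _ _ _ _ _ (by omega) (by omega) (by omega) (by omega))
          (ih _ _ _ _ _ _ _ (by omega) (by omega) (by omega) (by omega)))
        (fun h => le_min
          (ih _ _ _ _ _ _ _ (by omega) (by omega) (by omega) (by omega))
          (ih _ _ _ _ _ _ _ (by omega) (by omega) (by omega) (by omega)))
      have t2 := coef_mono k k' (x := w 0 j (k - 1) l)
        (y := w (i' - 1) (j' + min i' 1) (k' - 1) l') (z := w 0 j k l) hk S.m1.le
        (fun h => ih _ _ _ _ _ _ _ (by omega) (by omega) (by omega) (by omega))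
        (fun h => ih _ _ _ _ _ _ _ (by omega) (by omega) (by omega) (by omega))
      have t3 := coef_mono (min l CG) (min l' CG) (x := w 0 j k (l - 1))
        (y := w (i' - 1) (j' + min i' 1) k' (l' - 1)) (z := w 0 j k l) (by omega) S.m2.le
        (fun h => ih _ _ _ _ _ _ _ (by omega) (by omega) (by omega) (by omega))
        (fun h => ih _ _ _ _ _ _ _ (by omega) (by omega) (by omega) (by omega))
      have c1 : (j : ℝ) * h0 ≤ ((i' : ℝ) + j') * h0 := by
        have : (j : ℝ) ≤ j' := by exact_mod_cast hj
        have : (0 : ℝ) ≤ i' := by positivity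
        exact mul_le_mul_of_nonneg_right (by linarith) S.p0.le
      have c2 : (k : ℝ) * h1 ≤ (k' : ℝ) * h1 :=
        mul_le_mul_of_nonneg_right (by exact_mod_cast hk) S.p1.le
      have c3 : (l : ℝ) * h2 ≤ (l' : ℝ) * h2 :=
        mul_le_mul_of_nonneg_right (by exact_mod_cast hl) S.p2.le
      refine le_of_mul_le_mul_left ?_ hd
      linarith

/-- One additional phase-1 job, nobody waiting. -/
theorem extra1 (S : Sys μ0 μ1 μ2 h0 h1 h2 CG w) : ∀ n j k l : ℕ,
    2 * j + k + l ≤ n → w 0 j (k + 1) l ≤ w 0 j k l + h1 / μ1 := by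
  intro n
  induction n using Nat.strong_induction_on with
  | _ n ih =>
    intro j k l hn
    have hd := d_pos S.m0 S.m1 S.m2 S.cg j (k + 1) l (by omega)
    have eA := S.eq 0 j (k + 1) l (Or.inl rfl)
    have eB := S.eq 0 j k l (Or.inl rfl)
    simp only [Nat.zero_sub, Nat.zero_min, Nat.add_zero, Nat.cast_zero, zero_add,
      Nat.add_sub_cancel] at eA eB
    have hC : μ1 * (h1 / μ1) = h1 := mul_div_cancel₀ _ S.m1.ne'
    have t1 := coef_le j (x := min (w 0 (j - 1) (k + 1 + 1) l) (w 0 (j - 1) (k + 1) (l + 1)))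
      (y := min (w 0 (j - 1) (k + 1) l) (w 0 (j - 1) k (l + 1)) + h1 / μ1) S.m0.le
      (fun h => by
        rw [← min_add_add_right]
        exact min_le_min (ih (n - 1) (by omega) _ _ _ (by omega))
          (ih (n - 1) (by omega) _ _ _ (by omega)))
    have t2 := coef_le k (x := w 0 j k l) (y := w 0 j (k - 1) l + h1 / μ1) S.m1.le
      (fun h => by
        obtain ⟨k, rfl⟩ := Nat.exists_eq_add_of_le' h
        exact ih (n - 1) (by omega) _ _ _ (by omega))
    have t3 := coef_le (min l CG) (x := w 0 j (k + 1) (l - 1)) (y := w 0 j k (l - 1) + h1 / μ1)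
      S.m2.le (fun h => ih (n - 1) (by omega) _ _ _ (by omega))
    refine le_of_mul_le_mul_left ?_ hd
    push_cast at *
    linarith

/-- Growth in the number of waiting jobs. -/
theorem growth (S : Sys μ0 μ1 μ2 h0 h1 h2 CG w) (Cp : ℕ) (hCp : 0 < Cp) (c : ℝ) (hc : 0 ≤ c)
    (hcd : c * (Cp * (μ0 + μ1 + μ2)) ≤ h0) : ∀ n i j k l : ℕ,
    2 * (i + j) + k + l ≤ n → j + k + l = Cp → w i j k l + c * i ≤ w (i + 1) j k l := by
  intro n
  induction n using Nat.strong_induction_on with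
  | _ n ih =>
    intro i j k l hn hs
    rcases i with _ | i
    · simpa using mono0 S _ _ _ _ _ _ _ _ le_rfl le_rfl le_rfl le_rfl
    · have hd := d_pos S.m0 S.m1 S.m2 S.cg j k l (by omega)
      have eA := S.eq (i + 1) j k l (Or.inr (by omega))
      have eB := S.eq (i + 1 + 1) j k l (Or.inr (by omega))
      have e1 : min (i + 1) 1 = 1 := by omega
      have e2 : min (i + 1 + 1) 1 = 1 := by omega
      simp only [e1, e2, Nat.add_sub_cancel] at eA eB
      have t1 := coef_le j
        (x := min (w (i + 1) (j - 1) (k + 1) l) (w (i + 1) (j - 1) k (l + 1)) + c * (i + 1))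
        (y := min (w (i + 1 + 1) (j - 1) (k + 1) l) (w (i + 1 + 1) (j - 1) k (l + 1))) S.m0.le
        (fun h => by
          rw [← min_add_add_right]
          have a1 := ih (n - 1) (by omega) (i + 1) (j - 1) (k + 1) l (by omega) (by omega)
          have a2 := ih (n - 1) (by omega) (i + 1) (j - 1) k (l + 1) (by omega) (by omega)
          push_cast at a1 a2
          exact min_le_min a1 a2)
      have t2 := coef_le k (x := w i (j + 1) (k - 1) l + c * i) (y := w (i + 1) (j + 1) (k - 1) l)
        S.m1.le (fun h => ih (n - 1) (by omega) _ _ _ _ (by omega) (by omega))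
      have t3 := coef_le (min l CG) (x := w i (j + 1) k (l - 1) + c * i)
        (y := w (i + 1) (j + 1) k (l - 1))
        S.m2.le (fun h => ih (n - 1) (by omega) _ _ _ _ (by omega) (by omega))
      have hb : c * ((k : ℝ) * μ1 + ((min l CG : ℕ) : ℝ) * μ2) ≤ h0 := by
        refine le_trans (mul_le_mul_of_nonneg_left ?_ hc) hcd
        have a1 : (k : ℝ) ≤ Cp := by exact_mod_cast (by omega : k ≤ Cp)
        have a2 : ((min l CG : ℕ) : ℝ) ≤ Cp := by exact_mod_cast (by omega : min l CG ≤ Cp)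
        have b1 := mul_le_mul_of_nonneg_right a1 S.m1.le
        have b2 := mul_le_mul_of_nonneg_right a2 S.m2.le
        have b3 : 0 ≤ (Cp : ℝ) * μ0 := mul_nonneg (by positivity) S.m0.le
        linarith
      refine le_of_mul_le_mul_left ?_ hd
      push_cast at *
      linarith

theorem mono_i (S : Sys μ0 μ1 μ2 h0 h1 h2 CG w) (i j k l m : ℕ) (h : 0 < j + k + l) :
    w i j k l ≤ w (i + m) j k l := by
  induction m with
  | zero => exact le_rfl
  | succ m ih =>
    have := growth S (j + k + l) h 0 le_rfl (by simpa using S.p0.le) _ (i + m) j k l le_rfl rfl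
    simp only [zero_mul, add_zero] at this
    exact ih.trans this

theorem delta_cases (l CG : ℕ) : ∃ δ : ℝ, 0 ≤ δ ∧ δ ≤ 1 ∧
    ((min (l + 1) CG : ℕ) : ℝ) = ((min l CG : ℕ) : ℝ) + δ ∧ (CG ≤ l → δ = 0) := by
  by_cases h : CG ≤ l
  · refine ⟨0, le_rfl, zero_le_one, ?_, fun _ => rfl⟩
    rw [min_eq_right h, min_eq_right (by omega)]; simp
  · refine ⟨1, zero_le_one, le_rfl, ?_, fun h' => absurd h' h⟩
    rw [min_eq_left (by omega), min_eq_left (by omega)]; simp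

theorem step3 (S : Sys μ0 μ1 μ2 h0 h1 h2 CG w) (i j k l m : ℕ) (C E δ : ℝ)
    (hδ0 : 0 ≤ δ) (hδ1 : δ ≤ 1)
    (hδ : ((min (l + 1) CG : ℕ) : ℝ) = ((min l CG : ℕ) : ℝ) + δ)
    (hj : 1 ≤ j → w (i + 1) (j - 1) (k + 1 + 1) l ≤ w (i + 1 + m) (j - 1) (k + 1) (l + 1) + C)
    (hj' : 1 ≤ j →
      w (i + 1) (j - 1) (k + 1) (l + 1) ≤ w (i + 1 + m) (j - 1) k (l + 1 + 1) + C)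
    (hk : 1 ≤ k → w i (j + 1) k l ≤ w (i + m) (j + 1) (k - 1) (l + 1) + C)
    (hl : 1 ≤ l → w i (j + 1) (k + 1) (l - 1) ≤ w (i + m) (j + 1) k l + C)
    (hE : w i (j + 1) k l ≤ w (i + 1 + m) j k (l + 1) + E) :
    ((j : ℝ) * μ0 + k * μ1 + ((min l CG : ℕ) : ℝ) * μ2 + μ1) *
      (w (i + 1) j (k + 1) l - w (i + 1 + m) j k (l + 1)) ≤
      h1 - m * h0 + ((j : ℝ) * μ0 + k * μ1 + ((min l CG : ℕ) : ℝ) * μ2) * C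
        + (μ1 - δ * μ2) * E := by
  have eA := S.eq (i + 1) j (k + 1) l (Or.inr (by omega))
  have eB := S.eq (i + 1 + m) j k (l + 1) (Or.inr (by omega))
  have e1 : min (i + 1) 1 = 1 := by omega
  have e2 : min (i + 1 + m) 1 = 1 := by omega
  have e3 : i + 1 + m - 1 = i + m := by omega
  simp only [e1, e2, e3, Nat.add_sub_cancel] at eA eB
  rw [hδ] at eB
  have t1 := coef_le j
    (x := min (w (i + 1) (j - 1) (k + 1 + 1) l) (w (i + 1) (j - 1) (k + 1) (l + 1)))
    (y := min (w (i + 1 + m) (j - 1) (k + 1) (l + 1)) (w (i + 1 + m) (j - 1) k (l + 1 + 1)) + C)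
    S.m0.le (fun h => by
      rw [← min_add_add_right]
      exact min_le_min (hj h) (hj' h))
  have t2 := coef_le k S.m1.le hk
  have t3 := coef_le (min l CG) S.m2.le (fun h => hl (by omega))
  have t4 : δ * μ2 * w i (j + 1) k l ≤ δ * μ2 * w (i + m) (j + 1) k l :=
    mul_le_mul_of_nonneg_left (mono_i S _ _ _ _ _ (by omega)) (mul_nonneg hδ0 S.m2.le)
  have t5 : (μ1 - δ * μ2) * w i (j + 1) k l ≤ (μ1 - δ * μ2) * (w (i + 1 + m) j k (l + 1) + E) := by
    refine mul_le_mul_of_nonneg_left hE ?_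
    have := mul_le_mul_of_nonneg_right hδ1 S.m2.le
    linarith [S.m21]
  have := S.p2
  push_cast at *
  linarith

theorem step2 (S : Sys μ0 μ1 μ2 h0 h1 h2 CG w) (i j k l m : ℕ) (C E δ : ℝ)
    (hδ0 : 0 ≤ δ)
    (hδ : ((min (l + 1) CG : ℕ) : ℝ) = ((min l CG : ℕ) : ℝ) + δ)
    (hj : 1 ≤ j → w i j (k + 1) l ≤ w (i + 1 + m) (j - 1) (k + 1) (l + 1) + C)
    (hj' : 1 ≤ j → w i j k (l + 1) ≤ w (i + 1 + m) (j - 1) k (l + 1 + 1) + C)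
    (hk : 1 ≤ k → w (i - 1) (j + 1 + min i 1) (k - 1) l
      ≤ w (i + m) (j + 1) (k - 1) (l + 1) + C)
    (hl : 1 ≤ l → w (i - 1) (j + 1 + min i 1) k (l - 1) ≤ w (i + m) (j + 1) k l + C)
    (hE : w i j (k + 1) l ≤ w (i + 1 + m) j k (l + 1) + E) :
    ((j : ℝ) * μ0 + k * μ1 + ((min l CG : ℕ) : ℝ) * μ2 + μ0 + δ * μ2) *
      (w i (j + 1) k l - w (i + 1 + m) j k (l + 1)) ≤
      ((j : ℝ) * μ0 + k * μ1 + ((min l CG : ℕ) : ℝ) * μ2) * C + μ0 * E := by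
  have eA := S.eq i (j + 1) k l (Or.inr (by omega))
  have eB := S.eq (i + 1 + m) j k (l + 1) (Or.inr (by omega))
  have e2 : min (i + 1 + m) 1 = 1 := by omega
  have e3 : i + 1 + m - 1 = i + m := by omega
  simp only [e2, e3, Nat.add_sub_cancel] at eA eB
  rw [hδ] at eB
  have t1 := coef_le j
    (x := min (w i j (k + 1) l) (w i j k (l + 1)))
    (y := min (w (i + 1 + m) (j - 1) (k + 1) (l + 1)) (w (i + 1 + m) (j - 1) k (l + 1 + 1)) + C)
    S.m0.le (fun h => by
      rw [← min_add_add_right]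
      exact min_le_min (hj h) (hj' h))
  have t2 := coef_le k S.m1.le hk
  have t3 := coef_le (min l CG) S.m2.le (fun h => hl (by omega))
  have t4 : δ * μ2 * w i (j + 1) k l ≤ δ * μ2 * w (i + m) (j + 1) k l :=
    mul_le_mul_of_nonneg_left (mono_i S _ _ _ _ _ (by omega)) (mul_nonneg hδ0 S.m2.le)
  have t5 : μ0 * min (w i j (k + 1) l) (w i j k (l + 1))
      ≤ μ0 * (w (i + 1 + m) j k (l + 1) + E) :=
    mul_le_mul_of_nonneg_left ((min_le_left _ _).trans hE) S.m0.le
  have c1 : 0 ≤ (m : ℝ) * h0 := mul_nonneg (by positivity) S.p0.le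
  have := S.p2
  push_cast at *
  linarith

/-- Constant for the comparison of a system which is `m` jobs ahead. -/
noncomputable def CC (h1 μ1 : ℝ) (K m : ℕ) : ℝ := ((K - m : ℕ) : ℝ) * (h1 / μ1) + h1 / μ1

theorem CC_ge (S : Sys μ0 μ1 μ2 h0 h1 h2 CG w) (K m : ℕ) : h1 / μ1 ≤ CC h1 μ1 K m := by
  have := div_pos S.p1 S.m1
  unfold CC
  have : 0 ≤ ((K - m : ℕ) : ℝ) * (h1 / μ1) := by positivity
  linarith

theorem CC_step (S : Sys μ0 μ1 μ2 h0 h1 h2 CG w) (K m : ℕ) (hK : h1 ≤ K * h0) :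
    h1 - m * h0 + μ1 * CC h1 μ1 K (m + 1) ≤ μ1 * CC h1 μ1 K m := by
  have hC : μ1 * (h1 / μ1) = h1 := mul_div_cancel₀ _ S.m1.ne'
  unfold CC
  by_cases h : m < K
  · have e : K - m = (K - (m + 1)) + 1 := by omega
    rw [e]
    push_cast
    have : 0 ≤ (m : ℝ) * h0 := mul_nonneg (by positivity) S.p0.le
    linarith
  · have e : K - m = 0 := by omega
    have e' : K - (m + 1) = 0 := by omega
    rw [e, e']
    have : (K : ℝ) * h0 ≤ m * h0 :=
      mul_le_mul_of_nonneg_right (by exact_mod_cast (by omega : K ≤ m)) S.p0.le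
    linarith

theorem compare (S : Sys μ0 μ1 μ2 h0 h1 h2 CG w) (K : ℕ) (hK : h1 ≤ K * h0) : ∀ n i j k l m : ℕ,
    (4 * (i + j) + 2 * m + 2 * k + 2 * l + 2 ≤ n →
      w i j (k + 1) l ≤ w (i + m) j k (l + 1) + CC h1 μ1 K m) ∧
    (4 * (i + j) + 2 * m + 2 * k + 2 * l + 5 ≤ n →
      w i (j + 1) k l ≤ w (i + 1 + m) j k (l + 1) + CC h1 μ1 K (m + 1)) := by
  intro n
  induction n using Nat.strong_induction_on with
  | _ n ih =>
    intro i j k l m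
    have hpos := div_pos S.p1 S.m1
    obtain ⟨δ, hδ0, hδ1, hδ, -⟩ := delta_cases l CG
    have a0 : 0 ≤ (j : ℝ) * μ0 := mul_nonneg (by positivity) S.m0.le
    have a1 : 0 ≤ (k : ℝ) * μ1 := mul_nonneg (by positivity) S.m1.le
    have a2 : 0 ≤ ((min l CG : ℕ) : ℝ) * μ2 := mul_nonneg (by positivity) S.m2.le
    have a3 : 0 ≤ δ * μ2 := mul_nonneg hδ0 S.m2.le
    constructor
    · intro hn
      rcases i with _ | i
      · have b1 := extra1 S _ j k l le_rfl
        have b2 := mono0 S _ (0 + m) j k (l + 1) j k l le_rfl le_rfl le_rfl (by omega)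
        have b3 := CC_ge S K m
        linarith
      · have key := step3 S i j k l m (CC h1 μ1 K m) (CC h1 μ1 K (m + 1)) δ hδ0 hδ1 hδ
          (fun h => (ih (n - 1) (by omega) _ _ _ _ _).1 (by omega))
          (fun h => (ih (n - 1) (by omega) _ _ _ _ _).1 (by omega))
          (fun h => by
            obtain ⟨k, rfl⟩ := Nat.exists_eq_add_of_le' h
            exact (ih (n - 1) (by omega) _ _ _ _ _).1 (by omega))
          (fun h => by
            obtain ⟨l, rfl⟩ := Nat.exists_eq_add_of_le' h
            exact (ih (n - 1) (by omega) _ _ _ _ _).1 (by omega))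
          ((ih (n - 1) (by omega) i j k l m).2 (by omega))
        have b1 := CC_step S K m hK
        have b2 := CC_ge S K (m + 1)
        have b3 : 0 ≤ δ * μ2 * CC h1 μ1 K (m + 1) := mul_nonneg a3 (by linarith)
        have hd : 0 < (j : ℝ) * μ0 + k * μ1 + ((min l CG : ℕ) : ℝ) * μ2 + μ1 := by
          linarith [S.m1]
        rw [← sub_le_iff_le_add']
        refine le_of_mul_le_mul_left ?_ hd
        linarith
    · intro hn
      have b2 := CC_ge S K (m + 1)
      have e : i + (m + 1) = i + 1 + m := by omega
      have key := step2 S i j k l m (CC h1 μ1 K (m + 1)) (CC h1 μ1 K (m + 1)) δ hδ0 hδ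
        (fun h => by
          obtain ⟨j, rfl⟩ := Nat.exists_eq_add_of_le' h
          exact (ih (n - 1) (by omega) i j (k + 1) l m).2 (by omega))
        (fun h => by
          obtain ⟨j, rfl⟩ := Nat.exists_eq_add_of_le' h
          exact (ih (n - 1) (by omega) i j k (l + 1) m).2 (by omega))
        (fun h => by
          rcases i with _ | i
          · have := mono0 S _ (0 + m) (j + 1) (k - 1) (l + 1) (j + 1) (k - 1) l le_rfl le_rfl
              le_rfl (by omega)
            simp only [Nat.zero_sub, Nat.zero_min, Nat.add_zero] at *
            linarith
          · have := (ih (n - 1) (by omega) i (j + 1) (k - 1) l m).2 (by omega)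
            have e1 : min (i + 1) 1 = 1 := by omega
            rw [e1]
            exact this)
        (fun h => by
          rcases i with _ | i
          · have := mono0 S _ (0 + m) (j + 1) k l (j + 1) k (l - 1) le_rfl le_rfl
              le_rfl (by omega)
            simp only [Nat.zero_sub, Nat.zero_min, Nat.add_zero] at *
            linarith
          · obtain ⟨l, rfl⟩ := Nat.exists_eq_add_of_le' h
            have := (ih (n - 1) (by omega) i (j + 1) k l m).2 (by omega)
            have e1 : min (i + 1) 1 = 1 := by omega
            rw [e1]
            exact this)
        (by
          have := (ih (n - 1) (by omega) i j k l (m + 1)).1 (by omega)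
          rwa [e] at this)
      have b3 : 0 ≤ δ * μ2 * CC h1 μ1 K (m + 1) := mul_nonneg a3 (by linarith)
      have hd : 0 < (j : ℝ) * μ0 + k * μ1 + ((min l CG : ℕ) : ℝ) * μ2 + μ0 + δ * μ2 := by
        linarith [S.m0]
      rw [← sub_le_iff_le_add']
      refine le_of_mul_le_mul_left ?_ hd
      linarith

theorem final (S : Sys μ0 μ1 μ2 h0 h1 h2 CG w) (j k l : ℕ) (hl : CG ≤ l) :
    ∃ N : ℕ, ∀ i, N ≤ i → w i j (k + 1) l ≤ w i j k (l + 1) := by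
  obtain ⟨K, hK'⟩ := exists_nat_ge (h1 / h0)
  have hK : h1 ≤ K * h0 := by rwa [div_le_iff₀ S.p0] at hK'
  have P3 : ∀ i j k l m, w i j (k + 1) l ≤ w (i + m) j k (l + 1) + CC h1 μ1 K m :=
    fun i j k l m => (compare S K hK _ i j k l m).1 le_rfl
  have P2 : ∀ i j k l m, w i (j + 1) k l ≤ w (i + 1 + m) j k (l + 1) + CC h1 μ1 K (m + 1) :=
    fun i j k l m => (compare S K hK _ i j k l m).2 le_rfl
  have m0 := S.m0
  have m1 := S.m1
  have m2 := S.m2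
  have p0 := S.p0
  set Cp : ℕ := j + 1 + k + l with hCp
  have hCp0 : 0 < Cp := by omega
  have hCpR : (0 : ℝ) < Cp := by exact_mod_cast hCp0
  set c : ℝ := h0 / (Cp * (μ0 + μ1 + μ2)) with hc
  have hcpos : 0 < c := by positivity
  have hcd : c * (Cp * (μ0 + μ1 + μ2)) ≤ h0 := by
    rw [hc, div_mul_cancel₀]; positivity
  obtain ⟨δ, hδ0, hδ1, hδ, hδz⟩ := delta_cases l CG
  have hz := hδz hl
  subst hz
  set r : ℝ := (j : ℝ) * μ0 + k * μ1 + ((min l CG : ℕ) : ℝ) * μ2 with hr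
  have hr0 : 0 ≤ r := by positivity
  set C0 := CC h1 μ1 K 0
  set C1 := CC h1 μ1 K 1
  set C2 := CC h1 μ1 K 2
  -- two jobs ahead
  have E3 : ∀ i : ℕ, w i (j + 1) k l ≤ w (i + 2) j k (l + 1) + (C1 - c * i) := by
    intro i
    have g := growth S Cp hCp0 c hcpos.le hcd _ i (j + 1) k l le_rfl rfl
    have p := P2 (i + 1) j k l 0
    simp only [Nat.add_zero, Nat.zero_add] at p
    have : i + 1 + 1 = i + 2 := rfl
    rw [this] at p
    linarith
  have E2 : ∀ i : ℕ, w (i + 1) j (k + 1) l ≤ w (i + 2) j k (l + 1) +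
      (h1 - h0 + r * C1 + μ1 * (C1 - c * i)) / (r + μ1) := by
    intro i
    have key := step3 S i j k l 1 C1 (C1 - c * i) 0 le_rfl zero_le_one hδ
      (fun h => P3 _ _ _ _ _) (fun h => P3 _ _ _ _ _)
      (fun h => by
        obtain ⟨k, rfl⟩ := Nat.exists_eq_add_of_le' h
        exact P3 _ _ _ _ _)
      (fun h => by
        obtain ⟨l, rfl⟩ := Nat.exists_eq_add_of_le' h
        exact P3 _ _ _ _ _)
      (E3 i)
    rw [← sub_le_iff_le_add', le_div_iff₀ (by linarith)]
    have e : i + 1 + 1 = i + 2 := rfl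
    rw [e] at key
    simp only [Nat.cast_one, Nat.cast_zero, ← hr] at key
    linarith
  have E1 : ∀ i : ℕ, w (i + 1) (j + 1) k l ≤ w (i + 2) j k (l + 1) +
      (r * C1 + μ0 * ((h1 - h0 + r * C1 + μ1 * (C1 - c * i)) / (r + μ1))) / (r + μ0) := by
    intro i
    have e1 : min (i + 1) 1 = 1 := by omega
    have key := step2 S (i + 1) j k l 0 C1 _ 0 le_rfl hδ
      (fun h => by
        obtain ⟨j, rfl⟩ := Nat.exists_eq_add_of_le' h
        exact P2 _ _ _ _ _)
      (fun h => by
        obtain ⟨j, rfl⟩ := Nat.exists_eq_add_of_le' h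
        exact P2 _ _ _ _ _)
      (fun h => by
        rw [e1]
        exact P2 _ _ _ _ _)
      (fun h => by
        rw [e1]
        obtain ⟨l, rfl⟩ := Nat.exists_eq_add_of_le' h
        exact P2 _ _ _ _ _)
      (E2 i)
    rw [← sub_le_iff_le_add', le_div_iff₀ (by linarith)]
    have e : i + 1 + 1 + 0 = i + 2 := rfl
    rw [e] at key
    linarith
  have E0 : ∀ i : ℕ, (r + μ1) * (w (i + 2) j (k + 1) l - w (i + 2) j k (l + 1)) ≤
      h1 + r * C0 + μ1 * ((r * C1 + μ0 * ((h1 - h0 + r * C1 + μ1 * (C1 - c * i)) / (r + μ1)))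
        / (r + μ0)) := by
    intro i
    have key := step3 S (i + 1) j k l 0 C0 _ 0 le_rfl zero_le_one hδ
      (fun h => P3 _ _ _ _ _) (fun h => P3 _ _ _ _ _)
      (fun h => by
        obtain ⟨k, rfl⟩ := Nat.exists_eq_add_of_le' h
        exact P3 _ _ _ _ _)
      (fun h => by
        obtain ⟨l, rfl⟩ := Nat.exists_eq_add_of_le' h
        exact P3 _ _ _ _ _)
      (E1 i)
    have e : i + 1 + 1 + 0 = i + 2 := rfl
    have e' : i + 1 + 1 = i + 2 := rfl
    rw [e, e'] at key
    simp only [Nat.cast_one, Nat.cast_zero, ← hr] at key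
    linarith
  have hq1 : 0 < r + μ1 := by linarith
  have hq0 : 0 < r + μ0 := by linarith
  set A : ℝ := h1 + r * C0 + μ1 * ((r * C1 + μ0 * ((h1 - h0 + r * C1 + μ1 * C1) / (r + μ1)))
        / (r + μ0)) with hA
  set B : ℝ := μ1 * (μ0 * (μ1 * c / (r + μ1)) / (r + μ0)) with hB
  have hBpos : 0 < B := by positivity
  obtain ⟨N, hN⟩ := exists_nat_ge (A / B)
  refine ⟨N + 2, fun i hi => ?_⟩
  obtain ⟨i, rfl⟩ := Nat.exists_eq_add_of_le' (le_trans (by omega : 2 ≤ N + 2) hi)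
  have hNi : (N : ℝ) ≤ i := by exact_mod_cast (by omega : N ≤ i)
  have hAB : A ≤ i * B := by
    rw [div_le_iff₀ hBpos] at hN
    exact hN.trans (mul_le_mul_of_nonneg_right hNi hBpos.le)
  have e0 := E0 i
  have id : h1 + r * C0 + μ1 * ((r * C1 + μ0 * ((h1 - h0 + r * C1 + μ1 * (C1 - c * i)) / (r + μ1)))
        / (r + μ0)) = A - i * B := by
    rw [hA, hB]; ring
  rw [id] at e0
  have : (r + μ1) * (w (i + 2) j (k + 1) l - w (i + 2) j k (l + 1)) ≤ (r + μ1) * 0 := by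
    linarith
  have := le_of_mul_le_mul_left this hq1
  linarith

end

theorem stmt0 (Cp CG : ℕ) (μ0 μ1 μ2 h0 h1 h2 : ℝ)
    (hCp : 0 < Cp) (hCG : 0 < CG) (hCpCG : CG < Cp)
    (hμ0 : 0 < μ0) (hμ1 : 0 < μ1) (hμ2 : 0 < μ2)
    (hh0 : 0 < h0) (hh1 : 0 < h1) (hh2 : 0 < h2)
    (hμ : μ2 ≤ μ1) :
    ∀ j k l : ℕ, 1 ≤ j → j + k + l = Cp → CG ≤ l →
      ∃ N : ℕ, ∀ i : ℕ, N ≤ i →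
        v μ0 μ1 μ2 h0 h1 h2 CG i (j - 1) (k + 1) l - v μ0 μ1 μ2 h0 h1 h2 CG i (j - 1) k (l + 1) ≤ 0 := by
  intro j k l _ _ hl
  obtain ⟨N, hN⟩ := final (sys_v hCG hμ0 hμ1 hμ2 hh0 hh1 hh2 hμ) (j - 1) k l hl
  exact ⟨N, fun i hi => sub_nonpos.mpr (hN i hi)⟩
end

section
/- Suppose CG < Cp and μ1 > μ2 (strictly). Then for every triple (j,k,l) of natural numbers with j ≥ 1 and j+k+l = Cp (no restriction on l relative to CG), there exists a natural number N such that for all natural numbers i ≥ N one has D(i,j,k,l) = v(i,j-1,k+1,l) − v(i,j-1,k,l+1) ≤ 0. -/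
/-- Generator of the chain "always choose station 1" on the simplex, in coordinates `(k,l)`. -/
noncomputable def genQ (Cp CG : ℕ) (μ0 μ1 μ2 : ℝ) (e : ℕ → ℕ → ℝ) (k l : ℕ) : ℝ :=
  ((Cp - k - l : ℕ) : ℝ) * μ0 * (e (k + 1) l - e k l) + (k : ℝ) * μ1 * (e (k - 1) l - e k l)
    + ((min l CG : ℕ) : ℝ) * μ2 * (e k (l - 1) - e k l)

theorem genQ_terms (Cp CG : ℕ) (μ0 μ1 μ2 : ℝ) (hμ0 : 0 < μ0) (hμ1 : 0 < μ1) (hμ2 : 0 < μ2)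
    (e : ℕ → ℕ → ℝ) (M : ℝ) (hM : ∀ k l, k + l ≤ Cp → e k l ≤ M) (k l : ℕ) (hkl : k + l ≤ Cp)
    (hk : e k l = M) :
    ((Cp - k - l : ℕ) : ℝ) * μ0 * (e (k + 1) l - e k l) ≤ 0 ∧
    (k : ℝ) * μ1 * (e (k - 1) l - e k l) ≤ 0 ∧
    ((min l CG : ℕ) : ℝ) * μ2 * (e k (l - 1) - e k l) ≤ 0 := by
  refine ⟨?_, ?_, ?_⟩
  · rcases Nat.eq_zero_or_pos (Cp - k - l) with h | h
    · simp [h]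
    · apply mul_nonpos_of_nonneg_of_nonpos (by positivity)
      have := hM (k + 1) l (by omega)
      linarith
  · apply mul_nonpos_of_nonneg_of_nonpos (by positivity)
    have := hM (k - 1) l (by omega)
    linarith
  · apply mul_nonpos_of_nonneg_of_nonpos (by positivity)
    have := hM k (l - 1) (by omega)
    linarith

theorem exists_maximizer (Cp : ℕ) (e : ℕ → ℕ → ℝ) :
    ∃ k l, k + l ≤ Cp ∧ ∀ k' l', k' + l' ≤ Cp → e k' l' ≤ e k l := by
  obtain ⟨p, hp, hmax⟩ := Finset.exists_max_image
    ((Finset.range (Cp + 1) ×ˢ Finset.range (Cp + 1)).filter (fun p => p.1 + p.2 ≤ Cp))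
    (fun p => e p.1 p.2) ⟨(0, 0), by simp⟩
  refine ⟨p.1, p.2, (Finset.mem_filter.mp hp).2, fun k' l' h => ?_⟩
  exact hmax (k', l') (by simp; omega)

theorem genQ_const_nonpos (Cp CG : ℕ) (μ0 μ1 μ2 : ℝ) (hμ0 : 0 < μ0) (hμ1 : 0 < μ1) (hμ2 : 0 < μ2)
    (e : ℕ → ℕ → ℝ) (a : ℝ) (h : ∀ k l, k + l ≤ Cp → genQ Cp CG μ0 μ1 μ2 e k l = a) : a ≤ 0 := by
  obtain ⟨k, l, hkl, hmax⟩ := exists_maximizer Cp e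
  obtain ⟨h1, h2, h3⟩ := genQ_terms Cp CG μ0 μ1 μ2 hμ0 hμ1 hμ2 e _ hmax k l hkl rfl
  have := h k l hkl
  unfold genQ at this
  linarith

theorem genQ_zero_le (Cp CG : ℕ) (μ0 μ1 μ2 : ℝ) (hCG : 0 < CG)
    (hμ0 : 0 < μ0) (hμ1 : 0 < μ1) (hμ2 : 0 < μ2)
    (e : ℕ → ℕ → ℝ) (h : ∀ k l, k + l ≤ Cp → genQ Cp CG μ0 μ1 μ2 e k l = 0) :
    ∀ k l, k + l ≤ Cp → e k l ≤ e 0 0 := by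
  obtain ⟨k, l, hkl, hmax⟩ := exists_maximizer Cp e
  have stepk : ∀ n l', n + l' ≤ Cp → e n l' = e k l → e 0 l' = e k l := by
    intro n
    induction n with
    | zero => intro l' _ h; exact h
    | succ n ih =>
      intro l' hn he
      apply ih l' (by omega)
      obtain ⟨h1, h2, h3⟩ := genQ_terms Cp CG μ0 μ1 μ2 hμ0 hμ1 hμ2 e _ hmax (n + 1) l' hn he
      have := h (n + 1) l' hn
      unfold genQ at this
      have h4 : ((n + 1 : ℕ) : ℝ) * μ1 * (e (n + 1 - 1) l' - e (n + 1) l') = 0 := by linarith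
      have h5 : ((n + 1 : ℕ) : ℝ) * μ1 ≠ 0 := by positivity
      have h6 := (mul_eq_zero.mp h4).resolve_left h5
      simp only [Nat.add_sub_cancel] at h6
      linarith
  have stepl : ∀ n, n ≤ Cp → e 0 n = e k l → e 0 0 = e k l := by
    intro n
    induction n with
    | zero => intro _ h; exact h
    | succ n ih =>
      intro hn he
      apply ih (by omega)
      obtain ⟨h1, h2, h3⟩ := genQ_terms Cp CG μ0 μ1 μ2 hμ0 hμ1 hμ2 e _ hmax 0 (n + 1) (by omega) he
      have := h 0 (n + 1) (by omega)
      unfold genQ at this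
      have h4 : ((min (n + 1) CG : ℕ) : ℝ) * μ2 * (e 0 (n + 1 - 1) - e 0 (n + 1)) = 0 := by linarith
      have hm : 0 < min (n + 1) CG := by omega
      have h5 : ((min (n + 1) CG : ℕ) : ℝ) * μ2 ≠ 0 := by positivity
      have h6 := (mul_eq_zero.mp h4).resolve_left h5
      simp only [Nat.add_sub_cancel] at h6
      linarith
  have := stepl l (by omega) (stepk k l hkl rfl)
  rw [this]
  exact hmax

/-- Extension by zero of a function on the simplex. -/
noncomputable def extS (Cp : ℕ) (f : {p : Fin (Cp + 1) × Fin (Cp + 1) // p.1.1 + p.2.1 ≤ Cp} → ℝ)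
    (k l : ℕ) : ℝ :=
  if h : k + l ≤ Cp then f ⟨(⟨k, by omega⟩, ⟨l, by omega⟩), h⟩ else 0

theorem extS_add (Cp : ℕ) (f g : {p : Fin (Cp + 1) × Fin (Cp + 1) // p.1.1 + p.2.1 ≤ Cp} → ℝ)
    (k l : ℕ) : extS Cp (f + g) k l = extS Cp f k l + extS Cp g k l := by
  unfold extS; split_ifs <;> simp

theorem extS_smul (Cp : ℕ) (c : ℝ)
    (f : {p : Fin (Cp + 1) × Fin (Cp + 1) // p.1.1 + p.2.1 ≤ Cp} → ℝ)
    (k l : ℕ) : extS Cp (c • f) k l = c * extS Cp f k l := by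
  unfold extS; split_ifs <;> simp

/-- The Poisson operator. -/
noncomputable def poissonT (Cp CG : ℕ) (μ0 μ1 μ2 : ℝ) :
    ({p : Fin (Cp + 1) × Fin (Cp + 1) // p.1.1 + p.2.1 ≤ Cp} → ℝ) →ₗ[ℝ]
    ({p : Fin (Cp + 1) × Fin (Cp + 1) // p.1.1 + p.2.1 ≤ Cp} → ℝ) where
  toFun f := fun p => genQ Cp CG μ0 μ1 μ2 (extS Cp f) p.1.1.1 p.1.2.1 - extS Cp f 0 0
  map_add' f g := by
    funext p
    simp only [genQ, extS_add, Pi.add_apply]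
    ring
  map_smul' c f := by
    funext p
    simp only [genQ, extS_smul, Pi.smul_apply, smul_eq_mul, RingHom.id_apply]
    ring

theorem genQ_neg (Cp CG : ℕ) (μ0 μ1 μ2 : ℝ) (e : ℕ → ℕ → ℝ) (k l : ℕ) :
    genQ Cp CG μ0 μ1 μ2 (fun a b => - e a b) k l = - genQ Cp CG μ0 μ1 μ2 e k l := by
  unfold genQ; ring

theorem poisson_exists (Cp CG : ℕ) (μ0 μ1 μ2 : ℝ) (hCG : 0 < CG)
    (hμ0 : 0 < μ0) (hμ1 : 0 < μ1) (hμ2 : 0 < μ2) (f : ℕ → ℕ → ℝ) :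
    ∃ (e : ℕ → ℕ → ℝ) (b : ℝ), ∀ k l, k + l ≤ Cp → genQ Cp CG μ0 μ1 μ2 e k l = f k l + b := by
  have hinj : Function.Injective (poissonT Cp CG μ0 μ1 μ2) := by
    rw [← LinearMap.ker_eq_bot, LinearMap.ker_eq_bot']
    intro u hu
    have hq : ∀ k l, k + l ≤ Cp → genQ Cp CG μ0 μ1 μ2 (extS Cp u) k l = extS Cp u 0 0 := by
      intro k l hkl
      have := congrFun hu ⟨(⟨k, by omega⟩, ⟨l, by omega⟩), hkl⟩
      simp only [poissonT, LinearMap.coe_mk, AddHom.coe_mk, Pi.zero_apply] at this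
      linarith
    have ha := genQ_const_nonpos Cp CG μ0 μ1 μ2 hμ0 hμ1 hμ2 _ _ hq
    have hb := genQ_const_nonpos Cp CG μ0 μ1 μ2 hμ0 hμ1 hμ2 (fun a b => - extS Cp u a b)
      (- extS Cp u 0 0) (by intro k l hkl; rw [genQ_neg, hq k l hkl])
    have h0 : extS Cp u 0 0 = 0 := by linarith
    rw [h0] at hq
    have hc := genQ_zero_le Cp CG μ0 μ1 μ2 hCG hμ0 hμ1 hμ2 _ hq
    have hd := genQ_zero_le Cp CG μ0 μ1 μ2 hCG hμ0 hμ1 hμ2 (fun a b => - extS Cp u a b)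
      (by intro k l hkl; rw [genQ_neg, hq k l hkl, neg_zero])
    funext p
    have h1 := hc p.1.1.1 p.1.2.1 p.2
    have h2 := hd p.1.1.1 p.1.2.1 p.2
    have h3 : extS Cp u p.1.1.1 p.1.2.1 = u p := by
      unfold extS; rw [dif_pos p.2]
    rw [h3] at h1
    simp only [h3] at h2
    simp only [Pi.zero_apply]
    linarith
  obtain ⟨u, hu⟩ := LinearMap.injective_iff_surjective.mp hinj (fun p => f p.1.1.1 p.1.2.1)
  refine ⟨extS Cp u, extS Cp u 0 0, fun k l hkl => ?_⟩
  have := congrFun hu ⟨(⟨k, by omega⟩, ⟨l, by omega⟩), hkl⟩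
  simp only [poissonT, LinearMap.coe_mk, AddHom.coe_mk] at this
  linarith

theorem dRate_pos (Cp CG : ℕ) (μ0 μ1 μ2 : ℝ) (hCp : 0 < Cp) (hCG : 0 < CG)
    (hμ0 : 0 < μ0) (hμ1 : 0 < μ1) (hμ2 : 0 < μ2) (j k l : ℕ) (h : j + k + l = Cp) :
    0 < dRate μ0 μ1 μ2 CG j k l := by
  unfold dRate
  rcases Nat.eq_zero_or_pos j with hj | hj
  · rcases Nat.eq_zero_or_pos k with hk | hk
    · have : 0 < min l CG := by omega
      positivity
    · positivity
  · positivity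

theorem v_succ (Cp CG : ℕ) (μ0 μ1 μ2 h0 h1 h2 : ℝ) (hCp : 0 < Cp) (hCG : 0 < CG)
    (hμ0 : 0 < μ0) (hμ1 : 0 < μ1) (hμ2 : 0 < μ2) (i j k l : ℕ) (h : j + k + l = Cp) :
    dRate μ0 μ1 μ2 CG j k l * v μ0 μ1 μ2 h0 h1 h2 CG (i + 1) j k l =
      ((i : ℝ) + 1 + (j : ℝ)) * h0 + (k : ℝ) * h1 + (l : ℝ) * h2
      + (j : ℝ) * μ0 * min (v μ0 μ1 μ2 h0 h1 h2 CG (i + 1) (j - 1) (k + 1) l)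
                (v μ0 μ1 μ2 h0 h1 h2 CG (i + 1) (j - 1) k (l + 1))
      + (k : ℝ) * μ1 * v μ0 μ1 μ2 h0 h1 h2 CG i (j + 1) (k - 1) l
      + ((min l CG : ℕ) : ℝ) * μ2 * v μ0 μ1 μ2 h0 h1 h2 CG i (j + 1) k (l - 1) := by
  have hd := dRate_pos Cp CG μ0 μ1 μ2 hCp hCG hμ0 hμ1 hμ2 j k l h
  rw [v, mul_div_cancel₀ _ hd.ne']
  congr 1
  · congr 1
    · congr 1
      split_ifs with hj
      · rfl
      · have : j = 0 := by omega
        simp [this]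
    · split_ifs with hj
      · rfl
      · have : k = 0 := by omega
        simp [this]
  · split_ifs with hj
    · rfl
    · have : l = 0 := by omega
      simp [this]

/-- Bias contribution of `l` jobs at station 2. -/
noncomputable def phiB (ρ μ2 : ℝ) (CG : ℕ) : ℕ → ℝ
  | 0 => 0
  | l + 1 => phiB ρ μ2 CG l + ρ * ((l : ℝ) + 1) / (((min (l + 1) CG : ℕ) : ℝ) * μ2)

/-- Existence of an asymptotic solution. -/
theorem exists_V (Cp CG : ℕ) (μ0 μ1 μ2 h0 h1 h2 : ℝ)
    (hCp : 0 < Cp) (hCG : 0 < CG)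
    (hμ0 : 0 < μ0) (hμ1 : 0 < μ1) (hμ2 : 0 < μ2) (hh0 : 0 < h0) (hμ : μ2 < μ1) :
    ∃ (V : ℕ → ℕ → ℕ → ℝ) (a C : ℝ), 0 < a ∧
      (∀ i k l, k + l + 1 ≤ Cp → V i (k + 1) l - V i k (l + 1) ≤ C - a * i) ∧
      (∀ i j k l, j + k + l = Cp →
        dRate μ0 μ1 μ2 CG j k l * V (i + 1) k l =
        ((i : ℝ) + 1 + (j : ℝ)) * h0 + (k : ℝ) * h1 + (l : ℝ) * h2
        + (j : ℝ) * μ0 * V (i + 1) (k + 1) l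
        + (k : ℝ) * μ1 * V i (k - 1) l
        + ((min l CG : ℕ) : ℝ) * μ2 * V i k (l - 1)) := by
  obtain ⟨ρ, hρ⟩ : ∃ ρ, ρ = μ0 * μ1 / (μ0 + μ1) := ⟨_, rfl⟩
  have hρpos : 0 < ρ := by rw [hρ]; positivity
  have hCpR : (0 : ℝ) < Cp := by exact_mod_cast hCp
  obtain ⟨y, hy⟩ : ∃ y, y = ρ / μ1 := ⟨_, rfl⟩
  have hy1 : μ1 * y = ρ := by rw [hy]; field_simp
  have hy0 : μ0 * (1 - y) = ρ := by rw [hy, hρ]; field_simp; ring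
  obtain ⟨R, hR⟩ : ∃ R, R = Cp * ρ := ⟨_, rfl⟩
  have hRpos : 0 < R := by rw [hR]; positivity
  obtain ⟨α, hα⟩ : ∃ α, α = h0 / (2 * R) := ⟨_, rfl⟩
  have hαpos : 0 < α := by rw [hα]; positivity
  have hαR : 2 * α * R = h0 := by rw [hα]; field_simp
  obtain ⟨g, hg⟩ : ∃ g : ℕ → ℕ → ℝ, g = fun (k l : ℕ) => (Cp : ℝ) - k - l + y * k + phiB ρ μ2 CG l :=
    ⟨_, rfl⟩
  have hphi : ∀ l : ℕ, (((min (l + 1) CG : ℕ) : ℝ) * μ2) *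
      (phiB ρ μ2 CG (l + 1) - phiB ρ μ2 CG l) = ρ * ((l : ℝ) + 1) := by
    intro l
    have hm : 0 < min (l + 1) CG := by omega
    have hm' : (0 : ℝ) < ((min (l + 1) CG : ℕ) : ℝ) := by exact_mod_cast hm
    rw [phiB]
    field_simp
    ring
  have hG : ∀ k l, k + l ≤ Cp → genQ Cp CG μ0 μ1 μ2 g k l
      = (k : ℝ) * μ1 + ((min l CG : ℕ) : ℝ) * μ2 - R := by
    intro k l hkl
    obtain ⟨j, hj⟩ : ∃ j, j + k + l = Cp := ⟨Cp - k - l, by omega⟩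
    have hj' : Cp - k - l = j := by omega
    have hjR : (Cp : ℝ) = j + k + l := by rw [← hj]; push_cast; ring
    have e1 : (j : ℝ) * μ0 * (g (k + 1) l - g k l) = - (j * ρ) := by
      rw [hg]; push_cast; linear_combination (-(j : ℝ)) * hy0
    have e2 : (k : ℝ) * μ1 * (g (k - 1) l - g k l) = k * μ1 - k * ρ := by
      cases k with
      | zero => simp
      | succ k =>
        rw [hg]; simp only [Nat.add_sub_cancel]; push_cast
        linear_combination (-((k : ℝ) + 1)) * hy1
    have e3 : ((min l CG : ℕ) : ℝ) * μ2 * (g k (l - 1) - g k l)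
        = ((min l CG : ℕ) : ℝ) * μ2 - l * ρ := by
      cases l with
      | zero => simp
      | succ l =>
        have := hphi l
        rw [hg]; simp only [Nat.add_sub_cancel]
        generalize ((min (l + 1) CG : ℕ) : ℝ) = m at *
        push_cast
        linear_combination (-1 : ℝ) * this
    unfold genQ
    rw [hj', e1, e2, e3, hR, hjR]
    ring
  obtain ⟨e, b, he⟩ := poisson_exists Cp CG μ0 μ1 μ2 hCG hμ0 hμ1 hμ2
    (fun k l => - α * ((k : ℝ) * μ1 + ((min l CG : ℕ) : ℝ) * μ2)
      + 2 * α * ((k : ℝ) * μ1 * g (k - 1) l + ((min l CG : ℕ) : ℝ) * μ2 * g k (l - 1))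
      - (((Cp - k - l : ℕ) : ℝ) * h0 + k * h1 + l * h2))
  obtain ⟨β, hβ⟩ : ∃ β, β = b / R := ⟨_, rfl⟩
  have hβR : β * R = b := by rw [hβ]; field_simp
  obtain ⟨k1, l1, -, hmax⟩ := exists_maximizer Cp e
  obtain ⟨k2, l2, -, hmin⟩ := exists_maximizer Cp (fun k l => - e k l)
  obtain ⟨δ, hδ⟩ : ∃ δ, δ = ρ / μ2 - ρ / μ1 := ⟨_, rfl⟩
  have hδpos : 0 < δ := by
    have := div_lt_div_of_pos_left hρpos hμ2 hμ
    rw [hδ]; linarith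
  have hgap : ∀ k l, g (k + 1) l - g k (l + 1) ≤ - δ := by
    intro k l
    have hm : 0 < min (l + 1) CG := by omega
    have hm' : (0 : ℝ) < ((min (l + 1) CG : ℕ) : ℝ) := by exact_mod_cast hm
    have hml : ((min (l + 1) CG : ℕ) : ℝ) ≤ (l : ℝ) + 1 := by
      have : min (l + 1) CG ≤ l + 1 := min_le_left _ _
      exact_mod_cast this
    have : ρ / μ2 ≤ ρ * ((l : ℝ) + 1) / (((min (l + 1) CG : ℕ) : ℝ) * μ2) := by
      rw [div_le_div_iff₀ hμ2 (by positivity)]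
      have := mul_le_mul_of_nonneg_left hml (mul_pos hρpos hμ2).le
      linarith
    rw [hg]
    simp only [phiB]
    push_cast at this ⊢
    rw [hδ, ← hy]
    linarith
  refine ⟨fun i k l => α * (i : ℝ) ^ 2 + (2 * α * i + β) * g k l + β * i + e k l,
    2 * α * δ, |β| * (g 0 1 - g 1 0 + ∑ k ∈ Finset.range (Cp + 1), ∑ l ∈ Finset.range (Cp + 1),
      |g (k + 1) l - g k (l + 1)|) + (e k1 l1 - e k2 l2), by positivity, ?_, ?_⟩
  · intro i k l hkl
    have a1 := hmax (k + 1) l (by omega)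
    have a2 := hmin k (l + 1) (by omega)
    have a3 := hgap k l
    have a4 := hgap 0 0
    have a5 : |g (k + 1) l - g k (l + 1)| ≤ ∑ k ∈ Finset.range (Cp + 1),
        ∑ l ∈ Finset.range (Cp + 1), |g (k + 1) l - g k (l + 1)| := by
      refine le_trans ?_ (Finset.single_le_sum
        (f := fun k => ∑ l ∈ Finset.range (Cp + 1), |g (k + 1) l - g k (l + 1)|)
        (fun _ _ => Finset.sum_nonneg fun _ _ => abs_nonneg _)
        (Finset.mem_range.mpr (by omega : k < Cp + 1)))
      exact Finset.single_le_sum (f := fun l => |g (k + 1) l - g k (l + 1)|)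
        (fun _ _ => abs_nonneg _) (Finset.mem_range.mpr (by omega : l < Cp + 1))
    generalize (∑ k ∈ Finset.range (Cp + 1),
        ∑ l ∈ Finset.range (Cp + 1), |g (k + 1) l - g k (l + 1)|) = S at *
    have a6 : β * (g (k + 1) l - g k (l + 1)) ≤ |β| * (g 0 1 - g 1 0 + S) := by
      calc β * (g (k + 1) l - g k (l + 1)) ≤ |β * (g (k + 1) l - g k (l + 1))| := le_abs_self _
        _ = |β| * |g (k + 1) l - g k (l + 1)| := abs_mul _ _
        _ ≤ _ := mul_le_mul_of_nonneg_left (by simp only [zero_add] at a4; linarith) (abs_nonneg _)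
    have a7 : 2 * α * i * (g (k + 1) l - g k (l + 1)) ≤ 2 * α * i * (- δ) :=
      mul_le_mul_of_nonneg_left a3 (by positivity)
    linarith
  · intro i j k l hj
    have hj' : Cp - k - l = j := by omega
    have b1 := hG k l (by omega)
    have b2 := he k l (by omega)
    simp only [genQ, hj'] at b1 b2
    simp only [dRate]
    push_cast at b1 b2 ⊢
    linear_combination (-(2 * α * ((i : ℝ) + 1) + β)) * b1 - b2 + ((i : ℝ) + 1) * hαR + hβR

theorem step_bound (CG : ℕ) (μ0 μ1 μ2 A h1 h2 : ℝ) (hμ0 : 0 < μ0) (hμ1 : 0 < μ1) (hμ2 : 0 < μ2)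
    (j k l : ℕ) (hd : 0 < dRate μ0 μ1 μ2 CG j k l)
    (x X m M y Y z Z K : ℝ)
    (e1 : dRate μ0 μ1 μ2 CG j k l * x = A + (k : ℝ) * h1 + (l : ℝ) * h2 + (j : ℝ) * μ0 * m
      + (k : ℝ) * μ1 * y + ((min l CG : ℕ) : ℝ) * μ2 * z)
    (e2 : dRate μ0 μ1 μ2 CG j k l * X = A + (k : ℝ) * h1 + (l : ℝ) * h2 + (j : ℝ) * μ0 * M
      + (k : ℝ) * μ1 * Y + ((min l CG : ℕ) : ℝ) * μ2 * Z)
    (hm : j = 0 ∨ |m - M| ≤ K) (hy : k = 0 ∨ |y - Y| ≤ K) (hz : l = 0 ∨ |z - Z| ≤ K) :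
    |x - X| ≤ K := by
  have key : ∀ (n : ℕ) (c s t : ℝ), 0 < c → (n = 0 ∨ |s - t| ≤ K) →
      |(n : ℝ) * c * (s - t)| ≤ n * c * K := by
    intro n c s t hc h
    rcases h with h | h
    · simp [h]
    · rw [abs_mul, abs_of_nonneg (by positivity : 0 ≤ (n : ℝ) * c)]
      exact mul_le_mul_of_nonneg_left h (by positivity)
  have k1 := abs_le.mp (key j μ0 m M hμ0 hm)
  have k2 := abs_le.mp (key k μ1 y Y hμ1 hy)
  have k3 := abs_le.mp (key (min l CG) μ2 z Z hμ2 (hz.imp (fun h => by simp [h]) id))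
  have e3 : dRate μ0 μ1 μ2 CG j k l * (x - X) = (j : ℝ) * μ0 * (m - M)
      + (k : ℝ) * μ1 * (y - Y) + ((min l CG : ℕ) : ℝ) * μ2 * (z - Z) := by
    linear_combination e1 - e2
  have e4 : dRate μ0 μ1 μ2 CG j k l * K = (j : ℝ) * μ0 * K + (k : ℝ) * μ1 * K
      + ((min l CG : ℕ) : ℝ) * μ2 * K := by
    unfold dRate; ring
  rw [abs_le]
  constructor
  · refine le_of_mul_le_mul_left ?_ hd
    linarith [k1.1, k2.1, k3.1]
  · refine le_of_mul_le_mul_left ?_ hd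
    linarith [k1.2, k2.2, k3.2]

theorem stmt1 (Cp CG : ℕ) (μ0 μ1 μ2 h0 h1 h2 : ℝ)
    (hCp : 0 < Cp) (hCG : 0 < CG) (hCpCG : CG < Cp)
    (hμ0 : 0 < μ0) (hμ1 : 0 < μ1) (hμ2 : 0 < μ2)
    (hh0 : 0 < h0) (hh1 : 0 < h1) (hh2 : 0 < h2)
    (hμ : μ2 < μ1) :
    ∀ j k l : ℕ, 1 ≤ j → j + k + l = Cp →
      ∃ N : ℕ, ∀ i : ℕ, N ≤ i →
        v μ0 μ1 μ2 h0 h1 h2 CG i (j - 1) (k + 1) l - v μ0 μ1 μ2 h0 h1 h2 CG i (j - 1) k (l + 1) ≤ 0 := by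
  obtain ⟨V, a, C, ha, hgap, hV⟩ := exists_V Cp CG μ0 μ1 μ2 h0 h1 h2 hCp hCG hμ0 hμ1 hμ2 hh0 hμ
  obtain ⟨N, hN⟩ := exists_nat_gt (C / a)
  have hmin : ∀ i k l, N ≤ i → k + l + 1 ≤ Cp → V i (k + 1) l ≤ V i k (l + 1) := by
    intro i k l hi hkl
    have h1 := hgap i k l hkl
    have h2 : (N : ℝ) ≤ i := by exact_mod_cast hi
    have h3 : C < i * a := by
      rw [div_lt_iff₀ ha] at hN
      have := mul_le_mul_of_nonneg_right h2 ha.le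
      linarith
    linarith
  obtain ⟨p, q, -, hK⟩ := exists_maximizer Cp
    (fun k l => |v μ0 μ1 μ2 h0 h1 h2 CG N (Cp - k - l) k l - V N k l|)
  obtain ⟨K, hKdef⟩ : ∃ K, K = |v μ0 μ1 μ2 h0 h1 h2 CG N (Cp - p - q) p q - V N p q| := ⟨_, rfl⟩
  simp only [← hKdef] at hK
  have hbound : ∀ n j k l, j + k + l = Cp →
      |v μ0 μ1 μ2 h0 h1 h2 CG (N + n) j k l - V (N + n) k l| ≤ K := by
    intro n
    induction n with
    | zero =>
      intro j k l h
      have := hK k l (by omega)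
      rwa [show Cp - k - l = j by omega] at this
    | succ n ihn =>
      intro j
      induction j with
      | zero =>
        intro k l h
        have hd := dRate_pos Cp CG μ0 μ1 μ2 hCp hCG hμ0 hμ1 hμ2 0 k l h
        have e1 := v_succ Cp CG μ0 μ1 μ2 h0 h1 h2 hCp hCG hμ0 hμ1 hμ2 (N + n) 0 k l h
        have e2 := hV (N + n) 0 k l h
        exact step_bound CG μ0 μ1 μ2 _ _ _ hμ0 hμ1 hμ2 0 k l hd _ _ _ _ _ _ _ _ K e1 e2
          (Or.inl rfl) (by
            rcases Nat.eq_zero_or_pos k with hk | hk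
            · exact Or.inl hk
            · exact Or.inr (ihn (0 + 1) (k - 1) l (by omega))) (by
            rcases Nat.eq_zero_or_pos l with hk | hk
            · exact Or.inl hk
            · exact Or.inr (ihn (0 + 1) k (l - 1) (by omega)))
      | succ j ihj =>
        intro k l h
        have hd := dRate_pos Cp CG μ0 μ1 μ2 hCp hCG hμ0 hμ1 hμ2 (j + 1) k l h
        have e1 := v_succ Cp CG μ0 μ1 μ2 h0 h1 h2 hCp hCG hμ0 hμ1 hμ2 (N + n) (j + 1) k l h
        have e2 := hV (N + n) (j + 1) k l h
        rw [← min_eq_left (hmin (N + n + 1) k l (by omega) (by omega))] at e2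
        exact step_bound CG μ0 μ1 μ2 _ _ _ hμ0 hμ1 hμ2 (j + 1) k l hd _ _ _ _ _ _ _ _ K e1 e2
          (Or.inr (le_trans (abs_min_sub_min_le_max _ _ _ _)
            (max_le (ihj (k + 1) l (by omega)) (ihj k (l + 1) (by omega))))) (by
            rcases Nat.eq_zero_or_pos k with hk | hk
            · exact Or.inl hk
            · exact Or.inr (ihn (j + 1 + 1) (k - 1) l (by omega))) (by
            rcases Nat.eq_zero_or_pos l with hk | hk
            · exact Or.inl hk
            · exact Or.inr (ihn (j + 1 + 1) k (l - 1) (by omega)))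
  intro j k l hj hjkl
  obtain ⟨N', hN'⟩ := exists_nat_gt ((C + 2 * K) / a)
  refine ⟨N + N', fun i hi => ?_⟩
  have c1 := hbound (i - N) (j - 1) (k + 1) l (by omega)
  have c2 := hbound (i - N) (j - 1) k (l + 1) (by omega)
  rw [show N + (i - N) = i by omega] at c1 c2
  have c3 := hgap i k l (by omega)
  have c4 : (N' : ℝ) ≤ i := by exact_mod_cast (by omega : N' ≤ i)
  rw [div_lt_iff₀ ha] at hN'
  have c5 := mul_le_mul_of_nonneg_right c4 ha.le
  have c6 := (abs_le.mp c1).2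
  have c7 := (abs_le.mp c2).1
  linarith
end

section
/- Suppose CG < Cp, h1/μ1 ≤ h2/μ2 and 1/μ1 ≤ 1/μ2. Then for every decision state (i,j,k,l) ∈ X_D (with no restriction on l) one has D(i,j,k,l) = v(i,j-1,k+1,l) − v(i,j-1,k,l+1) ≤ 0; that is, the policy which never seeks collaborative care is optimal in every decision state. -/
/-- Value after a departure: one waiting patient, if any, is admitted. -/
noncomputable def depV (V : ℕ → ℕ → ℕ → ℕ → ℝ) : ℕ → ℕ → ℕ → ℕ → ℝ
  | 0, j, k, l => V 0 j k l
  | i + 1, j, k, l => V i (j + 1) k l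

theorem v_rec (μ0 μ1 μ2 h0 h1 h2 : ℝ) (CG : ℕ) (hCG : 0 < CG)
    (hμ0 : 0 < μ0) (hμ1 : 0 < μ1) (hμ2 : 0 < μ2) (i j k l : ℕ) (hpos : i = 0 ∨ 0 < j + k + l) :
    ((j : ℝ) * μ0 + (k : ℝ) * μ1 + ((min l CG : ℕ) : ℝ) * μ2) * v μ0 μ1 μ2 h0 h1 h2 CG i j k l =
      ((i : ℝ) + j) * h0 + (k : ℝ) * h1 + (l : ℝ) * h2
      + (j : ℝ) * μ0 * min (v μ0 μ1 μ2 h0 h1 h2 CG i (j - 1) (k + 1) l)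
          (v μ0 μ1 μ2 h0 h1 h2 CG i (j - 1) k (l + 1))
      + (k : ℝ) * μ1 * depV (v μ0 μ1 μ2 h0 h1 h2 CG) i j (k - 1) l
      + ((min l CG : ℕ) : ℝ) * μ2 * depV (v μ0 μ1 μ2 h0 h1 h2 CG) i j k (l - 1) := by
  by_cases hz : j + k + l = 0
  · have hi : i = 0 := by omega
    have hj : j = 0 := by omega
    have hk : k = 0 := by omega
    have hl : l = 0 := by omega
    subst hi hj hk hl
    simp
  have hd : 0 < (j : ℝ) * μ0 + (k : ℝ) * μ1 + ((min l CG : ℕ) : ℝ) * μ2 := by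
    have hc : 0 < j ∨ 0 < k ∨ 0 < min l CG := by omega
    rcases hc with h | h | h
    · have : (0 : ℝ) < j := by exact_mod_cast h
      positivity
    · have : (0 : ℝ) < k := by exact_mod_cast h
      positivity
    · have : (0 : ℝ) < ((min l CG : ℕ) : ℝ) := by exact_mod_cast h
      positivity
  have e1 : ∀ x : ℝ, (if _ : 1 ≤ j then (j : ℝ) * μ0 * x else 0) = (j : ℝ) * μ0 * x := by
    intro x
    split_ifs with h
    · rfl
    · have : j = 0 := by omega
      simp [this]
  have e2 : ∀ x : ℝ, (if _ : 1 ≤ k then (k : ℝ) * μ1 * x else 0) = (k : ℝ) * μ1 * x := by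
    intro x
    split_ifs with h
    · rfl
    · have : k = 0 := by omega
      simp [this]
  have e3 : ∀ x : ℝ, (if _ : 1 ≤ l then ((min l CG : ℕ) : ℝ) * μ2 * x else 0)
      = ((min l CG : ℕ) : ℝ) * μ2 * x := by
    intro x
    split_ifs with h
    · rfl
    · have : l = 0 := by omega
      simp [this]
  cases i with
  | zero =>
    rw [v.eq_2 _ _ _ _ _ _ _ _ _ _ (by intro a b c; omega), e1, e2, e3, dRate,
      mul_div_cancel₀ _ hd.ne']
    simp [depV]
  | succ i =>
    rw [v.eq_3, e1, e2, e3, dRate, mul_div_cancel₀ _ hd.ne']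
    simp [depV]

theorem rate_mono (n : ℕ) (μ a b : ℝ) (hμ : 0 < μ) (h : 1 ≤ n → a ≤ b) :
    (n : ℝ) * μ * a ≤ (n : ℝ) * μ * b := by
  rcases Nat.eq_zero_or_pos n with h0 | h0
  · simp [h0]
  · have := h h0
    gcongr

/-- Upper bound for the rate equation of the state reached after a departure. -/
theorem dep_upper (V : ℕ → ℕ → ℕ → ℕ → ℝ) (CG : ℕ) (μ0 μ1 μ2 h0 h1 h2 : ℝ) (hμ0 : 0 < μ0)
    (hrec : ∀ i j k l : ℕ, i = 0 ∨ 0 < j + k + l →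
      ((j : ℝ) * μ0 + (k : ℝ) * μ1 + ((min l CG : ℕ) : ℝ) * μ2) * V i j k l =
      ((i : ℝ) + j) * h0 + (k : ℝ) * h1 + (l : ℝ) * h2
      + (j : ℝ) * μ0 * min (V i (j - 1) (k + 1) l) (V i (j - 1) k (l + 1))
      + (k : ℝ) * μ1 * depV V i j (k - 1) l
      + ((min l CG : ℕ) : ℝ) * μ2 * depV V i j k (l - 1))
    (i j k l : ℕ) (h3 : ∀ i', i = i' + 1 → V i' j (k + 1) l ≤ V i' (j + 1) k l) :
    ((j : ℝ) * μ0 + (k : ℝ) * μ1 + ((min l CG : ℕ) : ℝ) * μ2) * depV V i j k l ≤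
      ((i : ℝ) + j) * h0 + (k : ℝ) * h1 + (l : ℝ) * h2
      + (j : ℝ) * μ0 * min (depV V i (j - 1) (k + 1) l) (depV V i (j - 1) k (l + 1))
      + (k : ℝ) * μ1 * depV (depV V) i j (k - 1) l
      + ((min l CG : ℕ) : ℝ) * μ2 * depV (depV V) i j k (l - 1) := by
  cases i with
  | zero => exact (hrec 0 j k l (Or.inl rfl)).le
  | succ i =>
    have h := hrec i (j + 1) k l (Or.inr (by omega))
    have h3' := h3 i rfl
    have hm : min (V i j (k + 1) l) (V i j k (l + 1)) ≤ V i (j + 1) k l :=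
      (min_le_left _ _).trans h3'
    have hm' := mul_le_mul_of_nonneg_left hm hμ0.le
    have ej : (j : ℝ) * μ0 * min (depV V (i + 1) (j - 1) (k + 1) l)
        (depV V (i + 1) (j - 1) k (l + 1))
        = (j : ℝ) * μ0 * min (V i j (k + 1) l) (V i j k (l + 1)) := by
      cases j <;> simp [depV]
    have es : ∀ k l, depV (depV V) (i + 1) j k l = depV V i (j + 1) k l := fun _ _ => rfl
    rw [ej, es, es]
    simp only [depV, Nat.add_sub_cancel] at h ⊢
    push_cast at h ⊢
    linarith

theorem main_ineq (V : ℕ → ℕ → ℕ → ℕ → ℝ) (CG : ℕ) (μ0 μ1 μ2 h0 h1 h2 : ℝ) (hCG : 0 < CG)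
    (hμ0 : 0 < μ0) (hμ1 : 0 < μ1) (hμ2 : 0 < μ2) (hh0 : 0 < h0) (hh2 : 0 < h2)
    (hq : h1 / μ1 ≤ h2 / μ2) (hμ : μ2 ≤ μ1)
    (hrec : ∀ i j k l : ℕ, i = 0 ∨ 0 < j + k + l →
      ((j : ℝ) * μ0 + (k : ℝ) * μ1 + ((min l CG : ℕ) : ℝ) * μ2) * V i j k l =
      ((i : ℝ) + j) * h0 + (k : ℝ) * h1 + (l : ℝ) * h2
      + (j : ℝ) * μ0 * min (V i (j - 1) (k + 1) l) (V i (j - 1) k (l + 1))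
      + (k : ℝ) * μ1 * depV V i j (k - 1) l
      + ((min l CG : ℕ) : ℝ) * μ2 * depV V i j k (l - 1)) (n : ℕ) :
    (∀ i j k l, 2 * (i + j) + k + l + 1 ≤ n → V i j (k + 1) l ≤ V i j k (l + 1)) ∧
    (∀ i j k l, 2 * (i + j) + k + l + 1 ≤ n → depV V i j k l + h2 / μ2 ≤ V i j k (l + 1)) ∧
    (∀ i j k l, 2 * (i + j) + k + l + 2 ≤ n → V i j (k + 1) l ≤ V i (j + 1) k l) ∧
    (∀ i j k l, 2 * (i + j) + k + l + 1 ≤ n → depV V i j k l + h1 / μ1 ≤ V i j (k + 1) l) := by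
  obtain ⟨p, hp⟩ : ∃ p, p = h1 / μ1 := ⟨_, rfl⟩
  obtain ⟨q, hqq⟩ : ∃ q, q = h2 / μ2 := ⟨_, rfl⟩
  have hp1 : h1 = p * μ1 := by rw [hp]; field_simp
  have hq1 : h2 = q * μ2 := by rw [hqq]; field_simp
  have hq0 : 0 < q := by rw [hqq]; positivity
  rw [← hp, ← hqq] at hq
  rw [← hp, ← hqq]
  clear hp hqq
  subst hp1 hq1
  induction n with
  | zero => refine ⟨?_, ?_, ?_, ?_⟩ <;> intros <;> omega
  | succ n ih =>
    obtain ⟨I1, I2, I3, I4⟩ := ih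
    -- versions of the induction hypotheses after a departure
    have S1 : ∀ i j k l, 2 * (i + j) + k + l + 1 ≤ n →
        depV V i j (k + 1) l ≤ depV V i j k (l + 1) := by
      intro i j k l h
      cases i with
      | zero => exact I1 _ _ _ _ h
      | succ i => exact I1 _ _ _ _ (by omega)
    have S2 : ∀ i j k l, 2 * (i + j) + k + l + 1 ≤ n →
        depV (depV V) i j k l + q ≤ depV V i j k (l + 1) := by
      intro i j k l h
      cases i with
      | zero => exact I2 _ _ _ _ h
      | succ i => exact I2 _ _ _ _ (by omega)
    have S3 : ∀ i j k l, 2 * (i + j) + k + l + 2 ≤ n →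
        depV V i j (k + 1) l ≤ depV V i (j + 1) k l := by
      intro i j k l h
      cases i with
      | zero => exact I3 _ _ _ _ h
      | succ i => exact I3 _ _ _ _ (by omega)
    have S4 : ∀ i j k l, 2 * (i + j) + k + l + 1 ≤ n →
        depV (depV V) i j k l + p ≤ depV V i j (k + 1) l := by
      intro i j k l h
      cases i with
      | zero => exact I4 _ _ _ _ h
      | succ i => exact I4 _ _ _ _ (by omega)
    have hU : ∀ i j k l, 2 * (i + j) + k + l ≤ n → _ := fun i j k l h =>
      dep_upper V CG μ0 μ1 μ2 h0 _ _ hμ0 hrec i j k l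
        (fun i' hi' => I3 i' j k l (by omega))
    have hR : ∀ j k l : ℕ,
        0 ≤ (j : ℝ) * μ0 + (k : ℝ) * μ1 + ((min l CG : ℕ) : ℝ) * μ2 := by
      intros; positivity
    have P2 : ∀ i j k l, 2 * (i + j) + k + l + 1 ≤ n + 1 →
        depV V i j k l + q ≤ V i j k (l + 1) := by
      intro i j k l h
      have hB := hrec i j k (l + 1) (Or.inr (by omega))
      have hS := hU i j k l (by omega)
      have tj : (j : ℝ) * μ0 * (min (depV V i (j - 1) (k + 1) l) (depV V i (j - 1) k (l + 1)) + q)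
          ≤ (j : ℝ) * μ0 * min (V i (j - 1) (k + 1) (l + 1)) (V i (j - 1) k (l + 1 + 1)) := by
        apply rate_mono _ _ _ _ hμ0
        intro hj
        rw [min_add_add_right _ _ _ |>.symm]
        exact min_le_min (I2 _ _ _ _ (by omega)) (I2 _ _ _ _ (by omega))
      have tk : (k : ℝ) * μ1 * (depV (depV V) i j (k - 1) l + q)
          ≤ (k : ℝ) * μ1 * depV V i j (k - 1) (l + 1) := by
        apply rate_mono _ _ _ _ hμ1
        intro hk
        exact S2 _ _ _ _ (by omega)
      have tl : ((min l CG : ℕ) : ℝ) * μ2 * (depV (depV V) i j k (l - 1) + q)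
          ≤ ((min l CG : ℕ) : ℝ) * μ2 * depV V i j k l := by
        apply rate_mono _ _ _ _ hμ2
        intro hl
        obtain ⟨l, rfl⟩ : ∃ l', l = l' + 1 := ⟨l - 1, by omega⟩
        exact S2 _ _ _ _ (by omega)
      have hR0 := hR j k l
      simp only [Nat.add_sub_cancel] at hB
      by_cases hl : l < CG
      · have em : ((min (l + 1) CG : ℕ) : ℝ) = ((min l CG : ℕ) : ℝ) + 1 := by
          rw [min_eq_left (by omega), min_eq_left (by omega)]; push_cast; ring
        rw [em] at hB
        generalize ((min l CG : ℕ) : ℝ) = m at *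
        push_cast at hB
        have key : 0 ≤ ((j : ℝ) * μ0 + k * μ1 + m * μ2 + μ2) *
            (V i j k (l + 1) - (depV V i j k l + q)) := by linarith
        have := nonneg_of_mul_nonneg_right key (by linarith)
        linarith
      · have em : ((min (l + 1) CG : ℕ) : ℝ) = ((min l CG : ℕ) : ℝ) := by
          rw [min_eq_right (by omega), min_eq_right (by omega)]
        have hm : (0 : ℝ) < ((min l CG : ℕ) : ℝ) := by
          rw [min_eq_right (by omega)]; exact_mod_cast hCG
        rw [em] at hB
        generalize ((min l CG : ℕ) : ℝ) = m at *
        push_cast at hB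
        have key : 0 ≤ ((j : ℝ) * μ0 + k * μ1 + m * μ2) *
            (V i j k (l + 1) - (depV V i j k l + q)) := by linarith
        have := nonneg_of_mul_nonneg_right key (by positivity)
        linarith
    have P4 : ∀ i j k l, 2 * (i + j) + k + l + 1 ≤ n + 1 →
        depV V i j k l + p ≤ V i j (k + 1) l := by
      intro i j k l h
      have hB := hrec i j (k + 1) l (Or.inr (by omega))
      have hS := hU i j k l (by omega)
      have tj : (j : ℝ) * μ0 * (min (depV V i (j - 1) (k + 1) l) (depV V i (j - 1) k (l + 1)) + p)
          ≤ (j : ℝ) * μ0 * min (V i (j - 1) (k + 1 + 1) l) (V i (j - 1) (k + 1) (l + 1)) := by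
        apply rate_mono _ _ _ _ hμ0
        intro hj
        rw [min_add_add_right _ _ _ |>.symm]
        exact min_le_min (I4 _ _ _ _ (by omega)) (I4 _ _ _ _ (by omega))
      have tk : (k : ℝ) * μ1 * (depV (depV V) i j (k - 1) l + p)
          ≤ (k : ℝ) * μ1 * depV V i j k l := by
        apply rate_mono _ _ _ _ hμ1
        intro hk
        obtain ⟨k, rfl⟩ : ∃ k', k = k' + 1 := ⟨k - 1, by omega⟩
        exact S4 _ _ _ _ (by omega)
      have tl : ((min l CG : ℕ) : ℝ) * μ2 * (depV (depV V) i j k (l - 1) + p)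
          ≤ ((min l CG : ℕ) : ℝ) * μ2 * depV V i j (k + 1) (l - 1) := by
        apply rate_mono _ _ _ _ hμ2
        intro hl
        exact S4 _ _ _ _ (by omega)
      have hR0 := hR j k l
      simp only [Nat.add_sub_cancel] at hB
      generalize ((min l CG : ℕ) : ℝ) = m at *
      push_cast at hB
      have key : 0 ≤ ((j : ℝ) * μ0 + k * μ1 + m * μ2 + μ1) *
          (V i j (k + 1) l - (depV V i j k l + p)) := by linarith
      have := nonneg_of_mul_nonneg_right key (by linarith)
      linarith
    have P1 : ∀ i j k l, 2 * (i + j) + k + l + 1 ≤ n + 1 →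
        V i j (k + 1) l ≤ V i j k (l + 1) := by
      intro i j k l h
      have hA := hrec i j (k + 1) l (Or.inr (by omega))
      have hB := hrec i j k (l + 1) (Or.inr (by omega))
      have h2' := P2 i j k l h
      have tj : (j : ℝ) * μ0 * min (V i (j - 1) (k + 1 + 1) l) (V i (j - 1) (k + 1) (l + 1))
          ≤ (j : ℝ) * μ0 * min (V i (j - 1) (k + 1) (l + 1)) (V i (j - 1) k (l + 1 + 1)) := by
        apply rate_mono _ _ _ _ hμ0
        intro hj
        exact min_le_min (I1 _ _ _ _ (by omega)) (I1 _ _ _ _ (by omega))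
      have tk : (k : ℝ) * μ1 * depV V i j k l
          ≤ (k : ℝ) * μ1 * depV V i j (k - 1) (l + 1) := by
        apply rate_mono _ _ _ _ hμ1
        intro hk
        obtain ⟨k, rfl⟩ : ∃ k', k = k' + 1 := ⟨k - 1, by omega⟩
        exact S1 _ _ _ _ (by omega)
      have tl : ((min l CG : ℕ) : ℝ) * μ2 * depV V i j (k + 1) (l - 1)
          ≤ ((min l CG : ℕ) : ℝ) * μ2 * depV V i j k l := by
        apply rate_mono _ _ _ _ hμ2
        intro hl
        obtain ⟨l, rfl⟩ : ∃ l', l = l' + 1 := ⟨l - 1, by omega⟩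
        exact S1 _ _ _ _ (by omega)
      have hR0 := hR j k l
      simp only [Nat.add_sub_cancel] at hA hB
      have a1 : 0 ≤ (μ1 - μ2) * (V i j k (l + 1) - (depV V i j k l + q)) :=
        mul_nonneg (by linarith) (by linarith)
      have a2 : 0 ≤ μ1 * (V i j k (l + 1) - (depV V i j k l + q)) :=
        mul_nonneg (by linarith) (by linarith)
      have a3 : 0 ≤ μ1 * (q - p) := mul_nonneg (by linarith) (by linarith)
      by_cases hl : l < CG
      · have em : ((min (l + 1) CG : ℕ) : ℝ) = ((min l CG : ℕ) : ℝ) + 1 := by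
          rw [min_eq_left (by omega), min_eq_left (by omega)]; push_cast; ring
        rw [em] at hB
        generalize ((min l CG : ℕ) : ℝ) = m at *
        push_cast at hA hB
        have key : 0 ≤ ((j : ℝ) * μ0 + k * μ1 + m * μ2 + μ1) *
            (V i j k (l + 1) - V i j (k + 1) l) := by linarith
        have := nonneg_of_mul_nonneg_right key (by linarith)
        linarith
      · have em : ((min (l + 1) CG : ℕ) : ℝ) = ((min l CG : ℕ) : ℝ) := by
          rw [min_eq_right (by omega), min_eq_right (by omega)]
        rw [em] at hB
        generalize ((min l CG : ℕ) : ℝ) = m at *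
        push_cast at hA hB
        have key : 0 ≤ ((j : ℝ) * μ0 + k * μ1 + m * μ2 + μ1) *
            (V i j k (l + 1) - V i j (k + 1) l) := by linarith
        have := nonneg_of_mul_nonneg_right key (by linarith)
        linarith
    have P3 : ∀ i j k l, 2 * (i + j) + k + l + 2 ≤ n + 1 →
        V i j (k + 1) l ≤ V i (j + 1) k l := by
      intro i j k l h
      have hA := hrec i j (k + 1) l (Or.inr (by omega))
      have hB := hrec i (j + 1) k l (Or.inr (by omega))
      have h4' := P4 i j k l (by omega)
      have hm : min (V i j (k + 1) l) (V i j k (l + 1)) = V i j (k + 1) l :=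
        min_eq_left (P1 i j k l (by omega))
      have tj : (j : ℝ) * μ0 * min (V i (j - 1) (k + 1 + 1) l) (V i (j - 1) (k + 1) (l + 1))
          ≤ (j : ℝ) * μ0 * V i j (k + 1) l := by
        apply rate_mono _ _ _ _ hμ0
        intro hj
        obtain ⟨j, rfl⟩ : ∃ j', j = j' + 1 := ⟨j - 1, by omega⟩
        exact (min_le_left _ _).trans (I3 _ _ _ _ (by omega))
      have tk : (k : ℝ) * μ1 * depV V i j k l
          ≤ (k : ℝ) * μ1 * depV V i (j + 1) (k - 1) l := by
        apply rate_mono _ _ _ _ hμ1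
        intro hk
        obtain ⟨k, rfl⟩ : ∃ k', k = k' + 1 := ⟨k - 1, by omega⟩
        exact S3 _ _ _ _ (by omega)
      have tl : ((min l CG : ℕ) : ℝ) * μ2 * depV V i j (k + 1) (l - 1)
          ≤ ((min l CG : ℕ) : ℝ) * μ2 * depV V i (j + 1) k (l - 1) := by
        apply rate_mono _ _ _ _ hμ2
        intro hl
        exact S3 _ _ _ _ (by omega)
      have hR0 := hR j k l
      simp only [Nat.add_sub_cancel, hm] at hA hB
      have a1 : 0 ≤ μ1 * (V i j (k + 1) l - (depV V i j k l + p)) :=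
        mul_nonneg (by linarith) (by linarith)
      generalize ((min l CG : ℕ) : ℝ) = m at *
      push_cast at hA hB
      have key : 0 ≤ ((j : ℝ) * μ0 + k * μ1 + m * μ2 + μ0) *
          (V i (j + 1) k l - V i j (k + 1) l) := by linarith
      have := nonneg_of_mul_nonneg_right key (by linarith)
      linarith
    exact ⟨P1, P2, P3, P4⟩

theorem stmt5 (Cp CG : ℕ) (μ0 μ1 μ2 h0 h1 h2 : ℝ)
    (hCp : 0 < Cp) (hCG : 0 < CG) (hCpCG : CG < Cp)
    (hμ0 : 0 < μ0) (hμ1 : 0 < μ1) (hμ2 : 0 < μ2)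
    (hh0 : 0 < h0) (hh1 : 0 < h1) (hh2 : 0 < h2)
    (hq : h1 / μ1 ≤ h2 / μ2) (hμ : 1 / μ1 ≤ 1 / μ2) :
    ∀ i j k l : ℕ, memX Cp i j k l → 1 ≤ j →
      v μ0 μ1 μ2 h0 h1 h2 CG i (j - 1) (k + 1) l - v μ0 μ1 μ2 h0 h1 h2 CG i (j - 1) k (l + 1) ≤ 0 := by
  intro i j k l _ _
  have hμ' : μ2 ≤ μ1 := (one_div_le_one_div hμ1 hμ2).mp hμ
  have h := (main_ineq (v μ0 μ1 μ2 h0 h1 h2 CG) CG μ0 μ1 μ2 h0 h1 h2 hCG hμ0 hμ1 hμ2 hh0 hh2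
    hq hμ' (v_rec μ0 μ1 μ2 h0 h1 h2 CG hCG hμ0 hμ1 hμ2) _).1 i (j - 1) k l le_rfl
  linarith
end

section
/- Suppose CG ≥ Cp, h1/μ1 ≥ h2/μ2 and μ1 > μ2. Then for every triple (j,k,l) of natural numbers with j ≥ 1 and j+k+l = Cp, there exists a natural number N such that for all natural numbers i ≥ N one has D(i,j,k,l) = v(i,j-1,k+1,l) − v(i,j-1,k,l+1) ≤ 0. -/
/-- Abstract form of the optimality equations on the state space (with `Cp ≤ CG`). -/
structure Sol (C : ℕ) (μ0 μ1 μ2 h0 h1 h2 : ℝ) (f : ℕ → ℕ → ℕ → ℕ → ℝ) : Prop where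
  hμ0 : 0 < μ0
  hμ1 : 0 < μ1
  hμ2 : 0 < μ2
  hh0 : 0 < h0
  hh1 : 0 < h1
  hh2 : 0 < h2
  H0 : ∀ j k l : ℕ, j + k + l ≤ C →
    ((j : ℝ) * μ0 + k * μ1 + l * μ2) * f 0 j k l = j * h0 + k * h1 + l * h2
      + j * μ0 * min (f 0 (j - 1) (k + 1) l) (f 0 (j - 1) k (l + 1))
      + k * μ1 * f 0 j (k - 1) l + l * μ2 * f 0 j k (l - 1)
  H1 : ∀ i j k l : ℕ, j + k + l = C →
    ((j : ℝ) * μ0 + k * μ1 + l * μ2) * f (i + 1) j k l = ((i : ℝ) + 1 + j) * h0 + k * h1 + l * h2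
      + j * μ0 * min (f (i + 1) (j - 1) (k + 1) l) (f (i + 1) (j - 1) k (l + 1))
      + k * μ1 * f i (j + 1) (k - 1) l + l * μ2 * f i (j + 1) k (l - 1)

/-- weighted comparison: `X + b ≤ Y` is only needed when the weight is nonzero. -/
theorem wcmp (n : ℕ) (m X Y b : ℝ) (hm : 0 < m) (h : 1 ≤ n → b ≤ Y - X) :
    (n : ℝ) * m * X + n * m * b ≤ n * m * Y := by
  rcases Nat.eq_zero_or_pos n with rfl | hn
  · simp
  · have h1 := h hn
    have h2 : 0 ≤ (n : ℝ) * m := by positivity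
    nlinarith

theorem min_cmp (a b c d t : ℝ) (h1 : t ≤ c - a) (h2 : t ≤ d - b) : t ≤ min c d - min a b := by
  have ha := min_le_left a b
  have hb := min_le_right a b
  rcases min_choice c d with h | h <;> rw [h] <;> linarith

section
variable {C : ℕ} {μ0 μ1 μ2 h0 h1 h2 : ℝ} {f : ℕ → ℕ → ℕ → ℕ → ℝ}

theorem Sol.L1k (S : Sol C μ0 μ1 μ2 h0 h1 h2 f) : ∀ n j k l : ℕ, 2 * j + k + l < n →
    j + k + l + 1 ≤ C → 0 ≤ f 0 j (k + 1) l - f 0 j k l := by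
  intro n
  induction n with
  | zero => intro j k l h; omega
  | succ n ih =>
    intro j k l hn hC
    have eB := S.H0 j (k + 1) l (by omega)
    have eA := S.H0 j k l (by omega)
    have hμ0 := S.hμ0
    have hμ1 := S.hμ1
    have hμ2 := S.hμ2
    have hh1 := S.hh1
    have t0 := wcmp j μ0 (min (f 0 (j - 1) (k + 1) l) (f 0 (j - 1) k (l + 1)))
      (min (f 0 (j - 1) (k + 1 + 1) l) (f 0 (j - 1) (k + 1) (l + 1))) 0 hμ0 (fun hj =>
        min_cmp _ _ _ _ _ (ih _ _ _ (by omega) (by omega)) (ih _ _ _ (by omega) (by omega)))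
    have t1 := wcmp k μ1 (f 0 j (k - 1) l) (f 0 j k l) 0 hμ1 (fun hk => by
        obtain ⟨k, rfl⟩ := Nat.exists_eq_add_of_le' hk
        exact ih _ _ _ (by omega) (by omega))
    have t2 := wcmp l μ2 (f 0 j k (l - 1)) (f 0 j (k + 1) (l - 1)) 0 hμ2 (fun hl =>
        ih _ _ _ (by omega) (by omega))
    have hΛ : 0 < (j : ℝ) * μ0 + (k + 1) * μ1 + l * μ2 := by positivity
    rw [Nat.add_sub_cancel] at eB
    push_cast at eB
    refine le_of_mul_le_mul_left ?_ hΛ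
    linarith

theorem Sol.L1l (S : Sol C μ0 μ1 μ2 h0 h1 h2 f) : ∀ n j k l : ℕ, 2 * j + k + l < n →
    j + k + l + 1 ≤ C → 0 ≤ f 0 j k (l + 1) - f 0 j k l := by
  intro n
  induction n with
  | zero => intro j k l h; omega
  | succ n ih =>
    intro j k l hn hC
    have eB := S.H0 j k (l + 1) (by omega)
    have eA := S.H0 j k l (by omega)
    have hμ0 := S.hμ0
    have hμ1 := S.hμ1
    have hμ2 := S.hμ2
    have hh2 := S.hh2
    have t0 := wcmp j μ0 (min (f 0 (j - 1) (k + 1) l) (f 0 (j - 1) k (l + 1)))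
      (min (f 0 (j - 1) (k + 1) (l + 1)) (f 0 (j - 1) k (l + 1 + 1))) 0 hμ0 (fun hj =>
        min_cmp _ _ _ _ _ (ih _ _ _ (by omega) (by omega)) (ih _ _ _ (by omega) (by omega)))
    have t1 := wcmp k μ1 (f 0 j (k - 1) l) (f 0 j (k - 1) (l + 1)) 0 hμ1 (fun hk =>
        ih _ _ _ (by omega) (by omega))
    have t2 := wcmp l μ2 (f 0 j k (l - 1)) (f 0 j k l) 0 hμ2 (fun hl => by
        obtain ⟨l, rfl⟩ := Nat.exists_eq_add_of_le' hl
        exact ih _ _ _ (by omega) (by omega))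
    have hΛ : 0 < (j : ℝ) * μ0 + k * μ1 + (l + 1) * μ2 := by positivity
    rw [Nat.add_sub_cancel] at eB
    push_cast at eB
    refine le_of_mul_le_mul_left ?_ hΛ
    linarith

theorem Sol.mk1 (S : Sol C μ0 μ1 μ2 h0 h1 h2 f) (j k l : ℕ) (h : j + k + l + 1 ≤ C) :
    0 ≤ f 0 j (k + 1) l - f 0 j k l := S.L1k _ j k l (Nat.lt_succ_self _) h

theorem Sol.ml1 (S : Sol C μ0 μ1 μ2 h0 h1 h2 f) (j k l : ℕ) (h : j + k + l + 1 ≤ C) :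
    0 ≤ f 0 j k (l + 1) - f 0 j k l := S.L1l _ j k l (Nat.lt_succ_self _) h

theorem Sol.L1j (S : Sol C μ0 μ1 μ2 h0 h1 h2 f) : ∀ n j k l : ℕ, 2 * j + k + l < n →
    j + k + l + 1 ≤ C → 0 ≤ f 0 (j + 1) k l - f 0 j k l := by
  intro n
  induction n with
  | zero => intro j k l h; omega
  | succ n ih =>
    intro j k l hn hC
    have eB := S.H0 (j + 1) k l (by omega)
    have eA := S.H0 j k l (by omega)
    have hμ0 := S.hμ0
    have hμ1 := S.hμ1
    have hμ2 := S.hμ2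
    have hh0 := S.hh0
    have t0 := wcmp j μ0 (min (f 0 (j - 1) (k + 1) l) (f 0 (j - 1) k (l + 1)))
      (min (f 0 j (k + 1) l) (f 0 j k (l + 1))) 0 hμ0 (fun hj => by
        obtain ⟨j, rfl⟩ := Nat.exists_eq_add_of_le' hj
        exact min_cmp _ _ _ _ _ (ih _ _ _ (by omega) (by omega)) (ih _ _ _ (by omega) (by omega)))
    have t1 := wcmp k μ1 (f 0 j (k - 1) l) (f 0 (j + 1) (k - 1) l) 0 hμ1 (fun hk =>
        ih _ _ _ (by omega) (by omega))
    have t2 := wcmp l μ2 (f 0 j k (l - 1)) (f 0 (j + 1) k (l - 1)) 0 hμ2 (fun hl =>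
        ih _ _ _ (by omega) (by omega))
    have t3 : μ0 * f 0 j k l ≤ μ0 * min (f 0 j (k + 1) l) (f 0 j k (l + 1)) := by
      refine mul_le_mul_of_nonneg_left (le_min ?_ ?_) hμ0.le
      · linarith [S.mk1 j k l (by omega)]
      · linarith [S.ml1 j k l (by omega)]
    have hΛ : 0 < ((j : ℝ) + 1) * μ0 + k * μ1 + l * μ2 := by positivity
    rw [Nat.add_sub_cancel] at eB
    push_cast at eB
    refine le_of_mul_le_mul_left ?_ hΛ
    linarith

theorem Sol.mj1 (S : Sol C μ0 μ1 μ2 h0 h1 h2 f) (j k l : ℕ) (h : j + k + l + 1 ≤ C) :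
    0 ≤ f 0 (j + 1) k l - f 0 j k l := S.L1j _ j k l (Nat.lt_succ_self _) h

theorem Sol.Lpos (S : Sol C μ0 μ1 μ2 h0 h1 h2 f) (hC : 0 < C) (j k l : ℕ) (h : j + k + l = C) :
    0 < (j : ℝ) * μ0 + k * μ1 + l * μ2 := by
  have hμ0 := S.hμ0
  have hμ1 := S.hμ1
  have hμ2 := S.hμ2
  rcases Nat.eq_zero_or_pos j with rfl | hj
  · rcases Nat.eq_zero_or_pos k with rfl | hk
    · have : 0 < l := by omega
      positivity
    · positivity
  · positivity

/-- One more customer in the queue costs at least linearly much. -/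
theorem Sol.L2 (S : Sol C μ0 μ1 μ2 h0 h1 h2 f) (hC : 0 < C) (c : ℝ) (hc0 : 0 ≤ c)
    (hc : ∀ j k l : ℕ, j + k + l ≤ C → c * ((j : ℝ) * μ0 + k * μ1 + l * μ2) ≤ h0) :
    ∀ n i j k l : ℕ, 2 * (i + j) + k + l < n →
    j + k + l = C → c * i ≤ f (i + 1) j k l - f i j k l := by
  intro n
  induction n with
  | zero => intro i j k l h; omega
  | succ n ih =>
    intro i j k l hn hjC
    have hμ0 := S.hμ0
    have hμ1 := S.hμ1
    have hμ2 := S.hμ2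
    have hh0 := S.hh0
    have hΛ := S.Lpos hC j k l hjC
    have hcc := hc j k l hjC.le
    have eB := S.H1 i j k l hjC
    have t0 := wcmp j μ0 (min (f i (j - 1) (k + 1) l) (f i (j - 1) k (l + 1)))
        (min (f (i + 1) (j - 1) (k + 1) l) (f (i + 1) (j - 1) k (l + 1))) (c * i) hμ0 (fun hj =>
          min_cmp _ _ _ _ _ (ih _ _ _ _ (by omega) (by omega)) (ih _ _ _ _ (by omega) (by omega)))
    cases i with
    | zero =>
      have eA := S.H0 j k l hjC.le
      have t1 := wcmp k μ1 (f 0 j (k - 1) l) (f 0 (j + 1) (k - 1) l) 0 hμ1 (fun hk =>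
        S.mj1 _ _ _ (by omega))
      have t2 := wcmp l μ2 (f 0 j k (l - 1)) (f 0 (j + 1) k (l - 1)) 0 hμ2 (fun hl =>
        S.mj1 _ _ _ (by omega))
      refine le_of_mul_le_mul_left ?_ hΛ
      push_cast at *
      linarith
    | succ i =>
      have eA := S.H1 i j k l hjC
      have t1 := wcmp k μ1 (f i (j + 1) (k - 1) l) (f (i + 1) (j + 1) (k - 1) l) (c * i) hμ1
        (fun hk => ih _ _ _ _ (by omega) (by omega))
      have t2 := wcmp l μ2 (f i (j + 1) k (l - 1)) (f (i + 1) (j + 1) k (l - 1)) (c * i) hμ2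
        (fun hl => ih _ _ _ _ (by omega) (by omega))
      refine le_of_mul_le_mul_left ?_ hΛ
      have : 0 ≤ (j : ℝ) * μ0 * c := by positivity
      push_cast at *
      linarith

/-- A finished server is worth linearly much compared with a server in phase 2. -/
theorem Sol.L3 (S : Sol C μ0 μ1 μ2 h0 h1 h2 f) (hC : 0 < C) (c e K : ℝ) (hc0 : 0 ≤ c)
    (hc : ∀ j k l : ℕ, j + k + l ≤ C → c * ((j : ℝ) * μ0 + k * μ1 + l * μ2) ≤ h0)
    (he0 : 0 ≤ e) (hK0 : 0 ≤ K) (he : (μ0 + μ2) * e = μ0 * c)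
    (hK : ∀ j k l : ℕ, j + k + l ≤ C →
      ((j : ℝ) * μ0 + k * μ1 + l * μ2) * e + μ0 * c ≤ (μ0 + μ2) * K) :
    ∀ n i j k l : ℕ, 2 * (i + j) + k + l < n →
    j + k + l + 1 = C → e * i + e - K ≤ f (i + 1) j k (l + 1) - f i (j + 1) k l := by
  intro n
  induction n with
  | zero => intro i j k l h; omega
  | succ n ih =>
    intro i j k l hn hjC
    have hμ0 := S.hμ0
    have hμ1 := S.hμ1
    have hμ2 := S.hμ2
    have hh2 := S.hh2
    have hΛ : 0 < ((j : ℝ) + 1) * μ0 + k * μ1 + (l + 1) * μ2 := by positivity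
    have hKK := hK j k l (by omega)
    have eB := S.H1 i j k (l + 1) (by omega)
    have t0 := wcmp j μ0 (min (f i j (k + 1) l) (f i j k (l + 1)))
        (min (f (i + 1) (j - 1) (k + 1) (l + 1)) (f (i + 1) (j - 1) k (l + 1 + 1)))
        (e * i + e - K) hμ0 (fun hj => by
          obtain ⟨j, rfl⟩ := Nat.exists_eq_add_of_le' hj
          exact min_cmp _ _ _ _ _ (ih _ _ _ _ (by omega) (by omega))
            (ih _ _ _ _ (by omega) (by omega)))
    have t3 : μ0 * (c * i) ≤
        μ0 * (f (i + 1) j k (l + 1) - min (f i j (k + 1) l) (f i j k (l + 1))) := by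
      refine mul_le_mul_of_nonneg_left ?_ hμ0.le
      have := S.L2 hC c hc0 hc _ i j k (l + 1) (Nat.lt_succ_self _) (by omega)
      linarith [min_le_right (f i j (k + 1) l) (f i j k (l + 1))]
    have p0 : 0 ≤ (j : ℝ) * μ0 * e := by positivity
    have hei := congrArg (fun t => t * (i : ℝ)) he
    rw [Nat.add_sub_cancel] at eB
    cases i with
    | zero =>
      have eA := S.H0 (j + 1) k l (by omega)
      have t1 := wcmp k μ1 (f 0 (j + 1) (k - 1) l) (f 0 (j + 1) (k - 1) (l + 1)) (-K) hμ1
        (fun hk => (neg_nonpos.2 hK0).trans (S.ml1 _ _ _ (by omega)))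
      have t2 := wcmp l μ2 (f 0 (j + 1) k (l - 1)) (f 0 (j + 1) k l) (-K) hμ2 (fun hl => by
        obtain ⟨l, rfl⟩ := Nat.exists_eq_add_of_le' hl
        exact (neg_nonpos.2 hK0).trans (S.ml1 _ _ _ (by omega)))
      rw [Nat.add_sub_cancel] at eA
      refine le_of_mul_le_mul_left ?_ hΛ
      push_cast at *
      linarith
    | succ i =>
      have eA := S.H1 i (j + 1) k l (by omega)
      have t1 := wcmp k μ1 (f i (j + 1 + 1) (k - 1) l) (f (i + 1) (j + 1) (k - 1) (l + 1))
        (e * i + e - K) hμ1 (fun hk => ih _ _ _ _ (by omega) (by omega))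
      have t2 := wcmp l μ2 (f i (j + 1 + 1) k (l - 1)) (f (i + 1) (j + 1) k l)
        (e * i + e - K) hμ2 (fun hl => by
        obtain ⟨l, rfl⟩ := Nat.exists_eq_add_of_le' hl
        exact ih _ _ _ _ (by omega) (by omega))
      rw [Nat.add_sub_cancel] at eA
      refine le_of_mul_le_mul_left ?_ hΛ
      push_cast at *
      linarith

theorem Sol.D0 (S : Sol C μ0 μ1 μ2 h0 h1 h2 f) (hμ : μ2 < μ1) (K : ℝ) (hK : h1 - h2 ≤ μ1 * K) :
    ∀ n j k l : ℕ, 2 * j + k + l < n →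
    j + k + l + 1 ≤ C → - K ≤ f 0 j k (l + 1) - f 0 j (k + 1) l := by
  intro n
  induction n with
  | zero => intro j k l h; omega
  | succ n ih =>
    intro j k l hn hjC
    have hμ0 := S.hμ0
    have hμ1 := S.hμ1
    have hμ2 := S.hμ2
    have eB := S.H0 j k (l + 1) (by omega)
    have eA := S.H0 j (k + 1) l (by omega)
    have t0 := wcmp j μ0 (min (f 0 (j - 1) (k + 1 + 1) l) (f 0 (j - 1) (k + 1) (l + 1)))
      (min (f 0 (j - 1) (k + 1) (l + 1)) (f 0 (j - 1) k (l + 1 + 1))) (-K) hμ0 (fun hj =>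
        min_cmp _ _ _ _ _ (ih _ _ _ (by omega) (by omega)) (ih _ _ _ (by omega) (by omega)))
    have t1 := wcmp k μ1 (f 0 j k l) (f 0 j (k - 1) (l + 1)) (-K) hμ1 (fun hk => by
        obtain ⟨k, rfl⟩ := Nat.exists_eq_add_of_le' hk
        exact ih _ _ _ (by omega) (by omega))
    have t2 := wcmp l μ2 (f 0 j (k + 1) (l - 1)) (f 0 j k l) (-K) hμ2 (fun hl => by
        obtain ⟨l, rfl⟩ := Nat.exists_eq_add_of_le' hl
        exact ih _ _ _ (by omega) (by omega))
    have t3 : 0 ≤ (μ1 - μ2) * (f 0 j k (l + 1) - f 0 j k l) :=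
      mul_nonneg (by linarith) (S.ml1 _ _ _ (by omega))
    have hΛ : 0 < (j : ℝ) * μ0 + (k + 1) * μ1 + l * μ2 := by positivity
    rw [Nat.add_sub_cancel] at eB eA
    refine le_of_mul_le_mul_left ?_ hΛ
    push_cast at *
    linarith

theorem Sol.D1 (S : Sol C μ0 μ1 μ2 h0 h1 h2 f) (hμ : μ2 < μ1) (e K a K' : ℝ)
    (hK : h1 - h2 ≤ μ1 * K')
    (hE : ∀ i j k l : ℕ, j + k + l + 1 = C →
      e * i + e - K ≤ f (i + 1) j k (l + 1) - f i (j + 1) k l)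
    (ha0 : 0 ≤ a) (ha : μ1 * a = (μ1 - μ2) * e)
    (hK' : ∀ j k l : ℕ, j + k + l ≤ C →
      h1 - h2 + ((j : ℝ) * μ0 + k * μ1 + l * μ2) * a + (μ1 - μ2) * K ≤ μ1 * K') :
    ∀ n i j k l : ℕ, 2 * (i + j) + k + l < n →
    j + k + l + 1 = C → a * i - K' ≤ f i j k (l + 1) - f i j (k + 1) l := by
  intro n
  induction n with
  | zero => intro i j k l h; omega
  | succ n ih =>
    intro i j k l hn hjC
    cases i with
    | zero =>
      have := S.D0 hμ K' hK _ j k l (Nat.lt_succ_self _) (by omega)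
      simpa using this
    | succ i =>
    have hμ0 := S.hμ0
    have hμ1 := S.hμ1
    have hμ2 := S.hμ2
    have hKK := hK' j k l (by omega)
    have eB := S.H1 i j k (l + 1) (by omega)
    have eA := S.H1 i j (k + 1) l (by omega)
    have t0 := wcmp j μ0
      (min (f (i + 1) (j - 1) (k + 1 + 1) l) (f (i + 1) (j - 1) (k + 1) (l + 1)))
      (min (f (i + 1) (j - 1) (k + 1) (l + 1)) (f (i + 1) (j - 1) k (l + 1 + 1)))
      (a * (i + 1 : ℕ) - K') hμ0 (fun hj =>
        min_cmp _ _ _ _ _ (ih _ _ _ _ (by omega) (by omega)) (ih _ _ _ _ (by omega) (by omega)))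
    have t1 := wcmp k μ1 (f i (j + 1) k l) (f i (j + 1) (k - 1) (l + 1)) (a * i - K') hμ1
      (fun hk => by
        obtain ⟨k, rfl⟩ := Nat.exists_eq_add_of_le' hk
        exact ih _ _ _ _ (by omega) (by omega))
    have t2 := wcmp l μ2 (f i (j + 1) (k + 1) (l - 1)) (f i (j + 1) k l) (a * i - K') hμ2
      (fun hl => by
        obtain ⟨l, rfl⟩ := Nat.exists_eq_add_of_le' hl
        exact ih _ _ _ _ (by omega) (by omega))
    have t3 := mul_le_mul_of_nonneg_left (hE i j k l hjC) (sub_pos.2 hμ).le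
    have hΛ : 0 < (j : ℝ) * μ0 + (k + 1) * μ1 + l * μ2 := by positivity
    have p0 : 0 ≤ (j : ℝ) * μ0 * a := by positivity
    have hai := congrArg (fun t => t * (i : ℝ)) ha
    rw [Nat.add_sub_cancel] at eB eA
    refine le_of_mul_le_mul_left ?_ hΛ
    push_cast at *
    linarith

theorem Sol.main (S : Sol C μ0 μ1 μ2 h0 h1 h2 f) (hC : 0 < C) (hμ : μ2 < μ1) :
    ∃ N : ℕ, ∀ i j k l : ℕ, j + k + l + 1 = C → N ≤ i →
      f i j (k + 1) l - f i j k (l + 1) ≤ 0 := by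
  have hμ0 := S.hμ0
  have hμ1 := S.hμ1
  have hμ2 := S.hμ2
  have hh0 := S.hh0
  have hd : 0 < μ1 - μ2 := sub_pos.2 hμ
  obtain ⟨R, hRdef⟩ : ∃ R : ℝ, R = C * (μ0 + μ1 + μ2) := ⟨_, rfl⟩
  have hR0 : 0 < R := by rw [hRdef]; positivity
  have hR : ∀ j k l : ℕ, j + k + l ≤ C → (j : ℝ) * μ0 + k * μ1 + l * μ2 ≤ R := by
    intro j k l h
    have hj : (j : ℝ) ≤ C := by exact_mod_cast (by omega : j ≤ C)
    have hk : (k : ℝ) ≤ C := by exact_mod_cast (by omega : k ≤ C)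
    have hl : (l : ℝ) ≤ C := by exact_mod_cast (by omega : l ≤ C)
    rw [hRdef]
    nlinarith
  obtain ⟨c, hc⟩ : ∃ c : ℝ, c = h0 / R := ⟨_, rfl⟩
  have hc0 : 0 < c := by rw [hc]; positivity
  have hcR : c * R = h0 := by rw [hc]; field_simp
  obtain ⟨e, he⟩ : ∃ e : ℝ, e = μ0 * c / (μ0 + μ2) := ⟨_, rfl⟩
  have he0 : 0 < e := by rw [he]; positivity
  have he' : (μ0 + μ2) * e = μ0 * c := by rw [he]; field_simp
  obtain ⟨K, hK⟩ : ∃ K : ℝ, K = (R * e + μ0 * c) / (μ0 + μ2) := ⟨_, rfl⟩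
  have hK0 : 0 < K := by rw [hK]; positivity
  have hK' : (μ0 + μ2) * K = R * e + μ0 * c := by rw [hK]; field_simp
  obtain ⟨a, ha⟩ : ∃ a : ℝ, a = (μ1 - μ2) * e / μ1 := ⟨_, rfl⟩
  have ha0 : 0 < a := by rw [ha]; positivity
  have ha' : μ1 * a = (μ1 - μ2) * e := by rw [ha]; field_simp
  obtain ⟨L, hL⟩ : ∃ L : ℝ, L = (h1 - h2 + R * a + (μ1 - μ2) * K) / μ1 := ⟨_, rfl⟩
  have hL' : μ1 * L = h1 - h2 + R * a + (μ1 - μ2) * K := by rw [hL]; field_simp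
  have hE := S.L3 hC c e K hc0.le
    (fun j k l h => by have := mul_le_mul_of_nonneg_left (hR j k l h) hc0.le; linarith)
    he0.le hK0.le he'
    (fun j k l h => by have := mul_le_mul_of_nonneg_right (hR j k l h) he0.le; linarith)
  have hD := S.D1 hμ e K a L (by rw [hL']; have := mul_pos hR0 ha0; have := mul_pos hd hK0; linarith)
    (fun i j k l h => hE _ i j k l (Nat.lt_succ_self _) h) ha0.le ha'
    (fun j k l h => by have := mul_le_mul_of_nonneg_right (hR j k l h) ha0.le; linarith)
  obtain ⟨N, hN⟩ := exists_nat_ge (L / a)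
  refine ⟨N, fun i j k l h hi => ?_⟩
  have h1 := hD _ i j k l (Nat.lt_succ_self _) h
  have h2 : L / a ≤ i := hN.trans (by exact_mod_cast hi)
  rw [div_le_iff₀ ha0] at h2
  linarith

end

theorem v_sol (Cp CG : ℕ) (μ0 μ1 μ2 h0 h1 h2 : ℝ) (hCp : 0 < Cp) (hCpCG : Cp ≤ CG)
    (hμ0 : 0 < μ0) (hμ1 : 0 < μ1) (hμ2 : 0 < μ2)
    (hh0 : 0 < h0) (hh1 : 0 < h1) (hh2 : 0 < h2) :
    Sol Cp μ0 μ1 μ2 h0 h1 h2 (v μ0 μ1 μ2 h0 h1 h2 CG) := by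
  have hpos : ∀ j k l : ℕ, ¬ (j = 0 ∧ k = 0 ∧ l = 0) →
      0 < (j : ℝ) * μ0 + k * μ1 + l * μ2 := by
    intro j k l h
    rcases Nat.eq_zero_or_pos j with rfl | hj
    · rcases Nat.eq_zero_or_pos k with rfl | hk
      · have : 0 < l := by omega
        positivity
      · positivity
    · positivity
  have hite : ∀ (n : ℕ) (m X : ℝ), (if _ : 1 ≤ n then (n : ℝ) * m * X else 0) = n * m * X := by
    intro n m X
    rcases Nat.eq_zero_or_pos n with rfl | hn
    · simp
    · rw [dif_pos (show 1 ≤ n from hn)]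
  refine ⟨hμ0, hμ1, hμ2, hh0, hh1, hh2, ?_, ?_⟩
  · intro j k l h
    by_cases hz : j = 0 ∧ k = 0 ∧ l = 0
    · obtain ⟨rfl, rfl, rfl⟩ := hz
      simp
    · have hp := hpos j k l hz
      have hl : min l CG = l := min_eq_left (by omega)
      conv_lhs => rw [v.eq_2 _ _ _ _ _ _ _ _ _ _ (by intro a b c; exact hz ⟨a, b, c⟩)]
      rw [dRate, hl, hite, hite, hite, mul_div_cancel₀ _ hp.ne']
  · intro i j k l h
    have hp := hpos j k l (by omega)
    have hl : min l CG = l := min_eq_left (by omega)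
    conv_lhs => rw [v.eq_3]
    rw [dRate, hl, hite, hite, hite, mul_div_cancel₀ _ hp.ne']

theorem stmt7 (Cp CG : ℕ) (μ0 μ1 μ2 h0 h1 h2 : ℝ)
    (hCp : 0 < Cp) (hCG : 0 < CG) (hCpCG : Cp ≤ CG)
    (hμ0 : 0 < μ0) (hμ1 : 0 < μ1) (hμ2 : 0 < μ2)
    (hh0 : 0 < h0) (hh1 : 0 < h1) (hh2 : 0 < h2)
    (hq : h2 / μ2 ≤ h1 / μ1) (hμ : μ2 < μ1) :
    ∀ j k l : ℕ, 1 ≤ j → j + k + l = Cp →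
      ∃ N : ℕ, ∀ i : ℕ, N ≤ i →
        v μ0 μ1 μ2 h0 h1 h2 CG i (j - 1) (k + 1) l - v μ0 μ1 μ2 h0 h1 h2 CG i (j - 1) k (l + 1) ≤ 0 := by
  intro j k l hj hC
  obtain ⟨N, hN⟩ := (v_sol Cp CG μ0 μ1 μ2 h0 h1 h2 hCp hCpCG hμ0 hμ1 hμ2 hh0 hh1 hh2).main hCp hμ
  exact ⟨N, fun i hi => hN i (j - 1) k l (by omega) hi⟩
end

section
/- Suppose CG ≥ Cp, h1/μ1 ≤ h2/μ2 and μ1 ≥ μ2. Then for every decision state (i,j,k,l) ∈ X_D one has D(i,j,k,l) = v(i,j-1,k+1,l) − v(i,j-1,k,l+1) ≤ 0. -/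
/-- Waiting-cost part of the value function under the policy that always uses station 1. -/
noncomputable def uW (μ0 μ1 μ2 h0 : ℝ) : ℕ → ℕ → ℕ → ℕ → ℝ
  | 0, _, _, _ => 0
  | i + 1, j, k, l =>
    (((i : ℝ) + 1) * h0
      + (if _ : 1 ≤ j then (j : ℝ) * μ0 * uW μ0 μ1 μ2 h0 (i + 1) (j - 1) (k + 1) l else 0)
      + (if _ : 1 ≤ k then (k : ℝ) * μ1 * uW μ0 μ1 μ2 h0 i (j + 1) (k - 1) l else 0)
      + (if _ : 1 ≤ l then (l : ℝ) * μ2 * uW μ0 μ1 μ2 h0 i (j + 1) k (l - 1) else 0))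
    / ((j : ℝ) * μ0 + (k : ℝ) * μ1 + (l : ℝ) * μ2)
termination_by i j k l => 2 * (i + j) + k + l
decreasing_by all_goals omega

theorem uW_zero (μ0 μ1 μ2 h0 : ℝ) (j k l : ℕ) : uW μ0 μ1 μ2 h0 0 j k l = 0 := by
  rw [uW]

theorem rate_pos {μ0 μ1 μ2 : ℝ} (hμ0 : 0 < μ0) (hμ1 : 0 < μ1) (hμ2 : 0 < μ2) (j k l : ℕ)
    (h : 0 < j + k + l) : 0 < (j : ℝ) * μ0 + (k : ℝ) * μ1 + (l : ℝ) * μ2 := by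
  have hj : 0 ≤ (j : ℝ) * μ0 := by positivity
  have hk : 0 ≤ (k : ℝ) * μ1 := by positivity
  have hl : 0 ≤ (l : ℝ) * μ2 := by positivity
  rcases Nat.eq_zero_or_pos j with rfl | h1
  · rcases Nat.eq_zero_or_pos k with rfl | h2
    · have : 0 < l := by omega
      have : 0 < (l : ℝ) * μ2 := by positivity
      linarith
    · have : 0 < (k : ℝ) * μ1 := by positivity
      linarith
  · have : 0 < (j : ℝ) * μ0 := by positivity
    linarith

theorem uW_succ {μ0 μ1 μ2 : ℝ} (h0 : ℝ) (hμ0 : 0 < μ0) (hμ1 : 0 < μ1) (hμ2 : 0 < μ2)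
    (i j k l : ℕ) (h : 0 < j + k + l) :
    ((j : ℝ) * μ0 + (k : ℝ) * μ1 + (l : ℝ) * μ2) * uW μ0 μ1 μ2 h0 (i + 1) j k l
      = ((i : ℝ) + 1) * h0
      + (j : ℝ) * μ0 * uW μ0 μ1 μ2 h0 (i + 1) (j - 1) (k + 1) l
      + (k : ℝ) * μ1 * uW μ0 μ1 μ2 h0 i (j + 1) (k - 1) l
      + (l : ℝ) * μ2 * uW μ0 μ1 μ2 h0 i (j + 1) k (l - 1) := by
  have hd := rate_pos hμ0 hμ1 hμ2 j k l h
  conv_lhs => rw [uW]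
  rw [mul_div_cancel₀ _ hd.ne']
  congr 1
  · congr 1
    · congr 1
      rcases j with _ | j <;> simp
    · rcases k with _ | k <;> simp
  · rcases l with _ | l <;> simp

theorem uW_nonneg {μ0 μ1 μ2 h0 : ℝ} (hμ0 : 0 < μ0) (hμ1 : 0 < μ1) (hμ2 : 0 < μ2)
    (hh0 : 0 < h0) (n : ℕ) : ∀ i j k l : ℕ, 2 * (i + j) + k + l ≤ n →
    0 ≤ uW μ0 μ1 μ2 h0 i j k l := by
  induction n with
  | zero =>
    intro i j k l h
    obtain rfl : i = 0 := by omega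
    rw [uW_zero]
  | succ n ih =>
    intro i j k l h
    rcases i with _ | i
    · rw [uW_zero]
    rw [uW]
    apply div_nonneg _ (by positivity)
    have e1 : 0 ≤ (if _ : 1 ≤ j then (j : ℝ) * μ0 * uW μ0 μ1 μ2 h0 (i + 1) (j - 1) (k + 1) l
        else 0) := by
      split_ifs
      · exact mul_nonneg (by positivity) (ih _ _ _ _ (by omega))
      · exact le_rfl
    have e2 : 0 ≤ (if _ : 1 ≤ k then (k : ℝ) * μ1 * uW μ0 μ1 μ2 h0 i (j + 1) (k - 1) l
        else 0) := by
      split_ifs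
      · exact mul_nonneg (by positivity) (ih _ _ _ _ (by omega))
      · exact le_rfl
    have e3 : 0 ≤ (if _ : 1 ≤ l then (l : ℝ) * μ2 * uW μ0 μ1 μ2 h0 i (j + 1) k (l - 1)
        else 0) := by
      split_ifs
      · exact mul_nonneg (by positivity) (ih _ _ _ _ (by omega))
      · exact le_rfl
    have e4 : 0 ≤ ((i : ℝ) + 1) * h0 := by positivity
    linarith

theorem term_le {μ : ℝ} (hμ : 0 < μ) (n : ℕ) (x y : ℝ) (h : 1 ≤ n → x ≤ y) :
    (n : ℝ) * μ * x ≤ (n : ℝ) * μ * y := by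
  rcases n with _ | n
  · simp
  · exact mul_le_mul_of_nonneg_left (h (by omega)) (by positivity)

/-- Departure helps, and being in a later phase helps. -/
theorem uW_mono {μ0 μ1 μ2 h0 : ℝ} (hμ0 : 0 < μ0) (hμ1 : 0 < μ1) (hμ2 : 0 < μ2)
    (hh0 : 0 < h0) (n : ℕ) : ∀ i j k l : ℕ,
    (2 * (i + j) + k + l + 1 ≤ n →
      uW μ0 μ1 μ2 h0 i (j + 1) k l ≤ uW μ0 μ1 μ2 h0 (i + 1) j (k + 1) l) ∧
    (2 * (i + j) + k + l ≤ n →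
      uW μ0 μ1 μ2 h0 i j (k + 1) l ≤ uW μ0 μ1 μ2 h0 i (j + 1) k l) := by
  induction n using Nat.strong_induction_on with
  | _ n ih =>
  have P2 : ∀ i j k l m : ℕ, m < n → 2 * (i + j) + k + l + 1 ≤ m →
      uW μ0 μ1 μ2 h0 i (j + 1) k l ≤ uW μ0 μ1 μ2 h0 (i + 1) j (k + 1) l :=
    fun i j k l m hm h => (ih m hm i j k l).1 h
  have P3 : ∀ i j k l m : ℕ, m < n → 2 * (i + j) + k + l ≤ m →
      uW μ0 μ1 μ2 h0 i j (k + 1) l ≤ uW μ0 μ1 μ2 h0 i (j + 1) k l :=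
    fun i j k l m hm h => (ih m hm i j k l).2 h
  intro i j k l
  have hdn : 0 ≤ (j : ℝ) * μ0 + (k : ℝ) * μ1 + (l : ℝ) * μ2 := by positivity
  constructor
  · intro hn
    rcases i with _ | i
    · rw [uW_zero]
      exact uW_nonneg hμ0 hμ1 hμ2 hh0 _ _ _ _ _ le_rfl
    have ea := uW_succ h0 hμ0 hμ1 hμ2 i (j + 1) k l (by omega)
    have eb := uW_succ h0 hμ0 hμ1 hμ2 (i + 1) j (k + 1) l (by omega)
    have t1 := term_le hμ0 j (uW μ0 μ1 μ2 h0 (i + 1) j (k + 1) l)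
      (uW μ0 μ1 μ2 h0 (i + 1 + 1) (j - 1) (k + 1 + 1) l) (by
        intro hj
        obtain ⟨j, rfl⟩ : ∃ m, j = m + 1 := ⟨j - 1, by omega⟩
        exact P2 (i + 1) j (k + 1) l (n - 1) (by omega) (by omega))
    have t2 := term_le hμ1 k (uW μ0 μ1 μ2 h0 i (j + 1 + 1) (k - 1) l)
      (uW μ0 μ1 μ2 h0 (i + 1) (j + 1) k l) (by
        intro hj
        obtain ⟨k, rfl⟩ : ∃ m, k = m + 1 := ⟨k - 1, by omega⟩
        exact P2 i (j + 1) k l (n - 1) (by omega) (by omega))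
    have t3 := term_le hμ2 l (uW μ0 μ1 μ2 h0 i (j + 1 + 1) k (l - 1))
      (uW μ0 μ1 μ2 h0 (i + 1) (j + 1) (k + 1) (l - 1)) (by
        intro hj
        exact P2 i (j + 1) k (l - 1) (n - 1) (by omega) (by omega))
    have t4 := mul_le_mul_of_nonneg_left (P3 (i + 1) j k l (n - 1) (by omega) (by omega)) hμ0.le
    simp only [Nat.add_sub_cancel] at ea eb
    push_cast at ea eb
    have hpos : 0 < (j : ℝ) * μ0 + (k : ℝ) * μ1 + (l : ℝ) * μ2 + μ1 := by linarith
    refine le_of_mul_le_mul_left ?_ hpos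
    linarith
  · intro hn
    rcases i with _ | i
    · rw [uW_zero, uW_zero]
    have ea := uW_succ h0 hμ0 hμ1 hμ2 i j (k + 1) l (by omega)
    have eb := uW_succ h0 hμ0 hμ1 hμ2 i (j + 1) k l (by omega)
    have t1 := term_le hμ0 j (uW μ0 μ1 μ2 h0 (i + 1) (j - 1) (k + 1 + 1) l)
      (uW μ0 μ1 μ2 h0 (i + 1) j (k + 1) l) (by
        intro hj
        obtain ⟨j, rfl⟩ : ∃ m, j = m + 1 := ⟨j - 1, by omega⟩
        exact P3 (i + 1) j (k + 1) l (n - 1) (by omega) (by omega))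
    have t2 := term_le hμ1 k (uW μ0 μ1 μ2 h0 i (j + 1) k l)
      (uW μ0 μ1 μ2 h0 i (j + 1 + 1) (k - 1) l) (by
        intro hj
        obtain ⟨k, rfl⟩ : ∃ m, k = m + 1 := ⟨k - 1, by omega⟩
        exact P3 i (j + 1) k l (n - 1) (by omega) (by omega))
    have t3 := term_le hμ2 l (uW μ0 μ1 μ2 h0 i (j + 1) (k + 1) (l - 1))
      (uW μ0 μ1 μ2 h0 i (j + 1 + 1) k (l - 1)) (by
        intro hj
        exact P3 i (j + 1) k (l - 1) (n - 1) (by omega) (by omega))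
    have t4 := mul_le_mul_of_nonneg_left (P2 i j k l (n - 1) (by omega) (by omega)) hμ1.le
    simp only [Nat.add_sub_cancel] at ea eb
    push_cast at ea eb
    have hpos : 0 < (j : ℝ) * μ0 + (k : ℝ) * μ1 + (l : ℝ) * μ2 + μ0 := by linarith
    refine le_of_mul_le_mul_left ?_ hpos
    linarith

/-- For the waiting cost, station 1 is at least as good as station 2. -/
theorem uW_swap {μ0 μ1 μ2 h0 : ℝ} (hμ0 : 0 < μ0) (hμ1 : 0 < μ1) (hμ2 : 0 < μ2)
    (hh0 : 0 < h0) (hμ : μ2 ≤ μ1) (n : ℕ) : ∀ i j k l : ℕ, 2 * (i + j) + k + l ≤ n →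
    uW μ0 μ1 μ2 h0 i j (k + 1) l ≤ uW μ0 μ1 μ2 h0 i j k (l + 1) := by
  induction n using Nat.strong_induction_on with
  | _ n ih =>
  intro i j k l hn
  rcases i with _ | i
  · rw [uW_zero, uW_zero]
  have hdn : 0 ≤ (j : ℝ) * μ0 + (k : ℝ) * μ1 + (l : ℝ) * μ2 := by positivity
  have ea := uW_succ h0 hμ0 hμ1 hμ2 i j (k + 1) l (by omega)
  have eb := uW_succ h0 hμ0 hμ1 hμ2 i j k (l + 1) (by omega)
  have t1 := term_le hμ0 j (uW μ0 μ1 μ2 h0 (i + 1) (j - 1) (k + 1 + 1) l)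
    (uW μ0 μ1 μ2 h0 (i + 1) (j - 1) (k + 1) (l + 1)) (by
      intro hj
      exact ih (n - 1) (by omega) (i + 1) (j - 1) (k + 1) l (by omega))
  have t2 := term_le hμ1 k (uW μ0 μ1 μ2 h0 i (j + 1) k l)
    (uW μ0 μ1 μ2 h0 i (j + 1) (k - 1) (l + 1)) (by
      intro hj
      obtain ⟨k, rfl⟩ : ∃ m, k = m + 1 := ⟨k - 1, by omega⟩
      exact ih (n - 1) (by omega) i (j + 1) k l (by omega))
  have t3 := term_le hμ2 l (uW μ0 μ1 μ2 h0 i (j + 1) (k + 1) (l - 1))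
    (uW μ0 μ1 μ2 h0 i (j + 1) k l) (by
      intro hj
      obtain ⟨l, rfl⟩ : ∃ m, l = m + 1 := ⟨l - 1, by omega⟩
      exact ih (n - 1) (by omega) i (j + 1) k l (by omega))
  have t4 := mul_le_mul_of_nonneg_left ((uW_mono hμ0 hμ1 hμ2 hh0 _ i j k l).1 le_rfl)
    (sub_nonneg.2 hμ)
  simp only [Nat.add_sub_cancel] at ea eb
  push_cast at ea eb
  have hpos : 0 < (j : ℝ) * μ0 + (k : ℝ) * μ1 + (l : ℝ) * μ2 + μ2 := by linarith
  refine le_of_mul_le_mul_left ?_ hpos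
  linarith

theorem v_eq (CG : ℕ) {μ0 μ1 μ2 h0 h1 h2 : ℝ}
    (hμ0 : 0 < μ0) (hμ1 : 0 < μ1) (hμ2 : 0 < μ2) (hh0 : 0 < h0)
    (hq : h1 / μ1 ≤ h2 / μ2) (hμ : μ2 ≤ μ1) (n : ℕ) :
    ∀ i j k l : ℕ, 2 * (i + j) + k + l ≤ n → j + k + l ≤ CG → (i = 0 ∨ 0 < j + k + l) →
      v μ0 μ1 μ2 h0 h1 h2 CG i j k l
        = ((i : ℝ) + j) * (h0 / μ0 + h1 / μ1) + k * (h1 / μ1) + l * (h2 / μ2)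
          + uW μ0 μ1 μ2 h0 i j k l := by
  induction n using Nat.strong_induction_on with
  | _ n ih =>
  intro i j k l hn hC hi
  by_cases hz : j + k + l = 0
  · obtain ⟨rfl, rfl, rfl, rfl⟩ : i = 0 ∧ j = 0 ∧ k = 0 ∧ l = 0 := by omega
    rw [v, uW_zero]
    simp
  have hd := rate_pos hμ0 hμ1 hμ2 j k l (by omega)
  have hmin : min l CG = l := by omega
  have c0 : h0 = h0 / μ0 * μ0 := by field_simp
  have c1 : h1 = h1 / μ1 * μ1 := by field_simp
  have c2 : h2 = h2 / μ2 * μ2 := by field_simp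
  have s1 : (if _ : 1 ≤ j then
          (j : ℝ) * μ0 *
            min (v μ0 μ1 μ2 h0 h1 h2 CG i (j - 1) (k + 1) l)
                (v μ0 μ1 μ2 h0 h1 h2 CG i (j - 1) k (l + 1))
        else 0) = (j : ℝ) * μ0 * (((i : ℝ) + j - 1) * (h0 / μ0 + h1 / μ1) + (k + 1) * (h1 / μ1)
          + l * (h2 / μ2) + uW μ0 μ1 μ2 h0 i (j - 1) (k + 1) l) := by
    split_ifs with hj
    · obtain ⟨j, rfl⟩ : ∃ m, j = m + 1 := ⟨j - 1, by omega⟩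
      simp only [Nat.add_sub_cancel]
      rw [ih (n - 1) (by omega) i j (k + 1) l (by omega) (by omega) (by omega),
        ih (n - 1) (by omega) i j k (l + 1) (by omega) (by omega) (by omega)]
      have hs := uW_swap hμ0 hμ1 hμ2 hh0 hμ _ i j k l le_rfl
      rw [min_eq_left (by push_cast; linarith)]
      push_cast
      ring
    · obtain rfl : j = 0 := by omega
      simp
  rcases i with _ | i
  · have s2 : (if _ : 1 ≤ k then (k : ℝ) * μ1 * v μ0 μ1 μ2 h0 h1 h2 CG 0 j (k - 1) l else 0)
        = (k : ℝ) * μ1 * ((j : ℝ) * (h0 / μ0 + h1 / μ1) + (k - 1) * (h1 / μ1)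
          + l * (h2 / μ2)) := by
      split_ifs with hk
      · obtain ⟨k, rfl⟩ : ∃ m, k = m + 1 := ⟨k - 1, by omega⟩
        simp only [Nat.add_sub_cancel]
        rw [ih (n - 1) (by omega) 0 j k l (by omega) (by omega) (by omega), uW_zero]
        push_cast
        ring
      · obtain rfl : k = 0 := by omega
        simp
    have s3 : (if _ : 1 ≤ l then
          ((min l CG : ℕ) : ℝ) * μ2 * v μ0 μ1 μ2 h0 h1 h2 CG 0 j k (l - 1)
        else 0) = (l : ℝ) * μ2 * ((j : ℝ) * (h0 / μ0 + h1 / μ1) + k * (h1 / μ1)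
          + (l - 1) * (h2 / μ2)) := by
      rw [hmin]
      split_ifs with hk
      · obtain ⟨l, rfl⟩ : ∃ m, l = m + 1 := ⟨l - 1, by omega⟩
        simp only [Nat.add_sub_cancel]
        rw [ih (n - 1) (by omega) 0 j k l (by omega) (by omega) (by omega), uW_zero]
        push_cast
        ring
      · obtain rfl : l = 0 := by omega
        simp
    rw [v]
    · rw [s1, s2, s3, dRate, hmin, div_eq_iff hd.ne', uW_zero, uW_zero]
      generalize h0 / μ0 = a at *
      generalize h1 / μ1 = b at *
      generalize h2 / μ2 = c at *
      subst c0 c1 c2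
      push_cast
      ring
    · intro a b c
      omega
  · have s2 : (if _ : 1 ≤ k then (k : ℝ) * μ1 * v μ0 μ1 μ2 h0 h1 h2 CG i (j + 1) (k - 1) l else 0)
        = (k : ℝ) * μ1 * (((i : ℝ) + j + 1) * (h0 / μ0 + h1 / μ1) + (k - 1) * (h1 / μ1)
          + l * (h2 / μ2) + uW μ0 μ1 μ2 h0 i (j + 1) (k - 1) l) := by
      split_ifs with hk
      · obtain ⟨k, rfl⟩ : ∃ m, k = m + 1 := ⟨k - 1, by omega⟩
        simp only [Nat.add_sub_cancel]
        rw [ih (n - 1) (by omega) i (j + 1) k l (by omega) (by omega) (by omega)]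
        push_cast
        ring
      · obtain rfl : k = 0 := by omega
        simp
    have s3 : (if _ : 1 ≤ l then
          ((min l CG : ℕ) : ℝ) * μ2 * v μ0 μ1 μ2 h0 h1 h2 CG i (j + 1) k (l - 1)
        else 0) = (l : ℝ) * μ2 * (((i : ℝ) + j + 1) * (h0 / μ0 + h1 / μ1) + k * (h1 / μ1)
          + (l - 1) * (h2 / μ2) + uW μ0 μ1 μ2 h0 i (j + 1) k (l - 1)) := by
      rw [hmin]
      split_ifs with hk
      · obtain ⟨l, rfl⟩ : ∃ m, l = m + 1 := ⟨l - 1, by omega⟩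
        simp only [Nat.add_sub_cancel]
        rw [ih (n - 1) (by omega) i (j + 1) k l (by omega) (by omega) (by omega)]
        push_cast
        ring
      · obtain rfl : l = 0 := by omega
        simp
    have eu := uW_succ h0 hμ0 hμ1 hμ2 i j k l (by omega)
    rw [v, s1, s2, s3, dRate, hmin, div_eq_iff hd.ne']
    push_cast
    have d1 : (j : ℝ) * h0 = j * (h0 / μ0 * μ0) := by rw [← c0]
    have d2 : (k : ℝ) * h1 = k * (h1 / μ1 * μ1) := by rw [← c1]
    have d3 : (l : ℝ) * h2 = l * (h2 / μ2 * μ2) := by rw [← c2]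
    generalize h0 / μ0 = a at *
    generalize h1 / μ1 = b at *
    generalize h2 / μ2 = c at *
    linear_combination d1 + d2 + d3 - eu

theorem stmt8 (Cp CG : ℕ) (μ0 μ1 μ2 h0 h1 h2 : ℝ)
    (hCp : 0 < Cp) (hCG : 0 < CG) (hCpCG : Cp ≤ CG)
    (hμ0 : 0 < μ0) (hμ1 : 0 < μ1) (hμ2 : 0 < μ2)
    (hh0 : 0 < h0) (hh1 : 0 < h1) (hh2 : 0 < h2)
    (hq : h1 / μ1 ≤ h2 / μ2) (hμ : μ2 ≤ μ1) :
    ∀ i j k l : ℕ, memX Cp i j k l → 1 ≤ j →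
      v μ0 μ1 μ2 h0 h1 h2 CG i (j - 1) (k + 1) l - v μ0 μ1 μ2 h0 h1 h2 CG i (j - 1) k (l + 1) ≤ 0 := by
  intro i j k l hX hj
  obtain ⟨j, rfl⟩ : ∃ m, j = m + 1 := ⟨j - 1, by omega⟩
  have hX' : j + 1 + k + l ≤ Cp := by
    rcases hX with h | h <;> omega
  simp only [Nat.add_sub_cancel]
  rw [v_eq CG hμ0 hμ1 hμ2 hh0 hq hμ _ i j (k + 1) l le_rfl (by omega) (by omega),
    v_eq CG hμ0 hμ1 hμ2 hh0 hq hμ _ i j k (l + 1) le_rfl (by omega) (by omega)]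
  have hs := uW_swap hμ0 hμ1 hμ2 hh0 hμ _ i j k l le_rfl
  push_cast
  linarith
end
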